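/- arXiv:1108.0458 — 8 statements merged into one kernel-verified Lean document; each statement's English description precedes it below -/
import Mathlib

section
/- The scalars θ_0, θ_1, …, θ_d are mutually distinct if and only if both of the following hold: (i) q^{2i} ≠ 1 for 1 ≤ i ≤ d; (ii) a² ≠ q^{2d−2i} for 1 ≤ i ≤ 2d−1. -/
/-- For nonzero `x`, `y`, the scalars `x + x⁻¹` and `y + y⁻¹` agree iff `x = y` or `x * y = 1`. -/
lemma add_inv_eq_add_inv_iff {K : Type*} [Field K] {x y : K} (hx : x ≠ 0) (hy : y ≠ 0) :
    x + x⁻¹ = y + y⁻¹ ↔ x = y ∨ x * y = 1 := by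
  have key : (x + x⁻¹ - (y + y⁻¹)) * (x * y) = (x - y) * (x * y - 1) := by
    field_simp
    ring
  rw [← sub_eq_zero, ← mul_eq_zero_iff_right (mul_ne_zero hx hy), key, mul_eq_zero,
    sub_eq_zero, sub_eq_zero]

lemma qRacah_eigenvalue_eq_iff {K : Type*} [Field K] {a q : K} (ha : a ≠ 0) (hq : q ≠ 0)
    (d i j : ℤ) :
    a * q ^ (2 * i - d) + a⁻¹ * q ^ (d - 2 * i) = a * q ^ (2 * j - d) + a⁻¹ * q ^ (d - 2 * j) ↔
      q ^ (2 * (i - j)) = 1 ∨ a ^ 2 = q ^ (2 * d - 2 * (i + j)) := by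
  have inv_term (k : ℤ) : a⁻¹ * q ^ (d - 2 * k) = (a * q ^ (2 * k - d))⁻¹ := by
    rw [mul_inv, ← zpow_neg, neg_sub]
  have ne_zero (k : ℤ) : a * q ^ (2 * k - d) ≠ 0 := mul_ne_zero ha (zpow_ne_zero _ hq)
  rw [inv_term, inv_term, add_inv_eq_add_inv_iff (ne_zero i) (ne_zero j)]
  refine or_congr ?_ ?_
  · rw [mul_right_inj' ha, ← div_eq_one_iff_eq (zpow_ne_zero _ hq), ← zpow_sub₀ hq]
    ring_nf
  · have hprod : a * q ^ (2 * i - d) * (a * q ^ (2 * j - d)) =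
        a ^ 2 * (q ^ (2 * d - 2 * (i + j)))⁻¹ := by
      rw [mul_mul_mul_comm, ← zpow_add₀ hq, ← zpow_neg, sq]
      ring_nf
    rw [hprod, mul_inv_eq_one₀ (zpow_ne_zero _ hq)]

/-- Lemma 4.2: the θ_i are mutually distinct iff (i) q^{2i} ≠ 1 for 1 ≤ i ≤ d and
(ii) a² ≠ q^{2d−2i} for 1 ≤ i ≤ 2d−1. -/
theorem stmt_1 {K : Type*} [Field K] [IsAlgClosed K] (d : ℕ) (a q : K)
    (ha : a ≠ 0) (hq : q ≠ 0) (hq1 : q ^ 2 ≠ 1) (hq2 : q ^ 2 ≠ -1)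
    (θ : ℕ → K)
    (hθ : ∀ i, i ≤ d →
      θ i = a * q ^ (2 * (i : ℤ) - (d : ℤ)) + a⁻¹ * q ^ ((d : ℤ) - 2 * (i : ℤ))) :
    (∀ i, i ≤ d → ∀ j, j ≤ d → i ≠ j → θ i ≠ θ j) ↔
      ((∀ i : ℕ, 1 ≤ i → i ≤ d → q ^ (2 * i) ≠ 1) ∧
       (∀ i : ℕ, 1 ≤ i → i ≤ 2 * d - 1 →
         a ^ 2 ≠ q ^ (2 * (d : ℤ) - 2 * (i : ℤ)))) := by
  have eq_iff (i j : ℕ) (hi : i ≤ d) (hj : j ≤ d) : θ i = θ j ↔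
      q ^ (2 * ((i : ℤ) - j)) = 1 ∨ a ^ 2 = q ^ (2 * (d : ℤ) - 2 * ((i : ℤ) + j)) := by
    rw [hθ i hi, hθ j hj, qRacah_eigenvalue_eq_iff ha hq]
  constructor
  · intro h
    refine ⟨fun i hi hid hqi => ?_, fun s hs hsd has => ?_⟩
    · refine h i hid 0 (Nat.zero_le d) (by omega) ((eq_iff i 0 hid (Nat.zero_le d)).2 (Or.inl ?_))
      rw [Nat.cast_zero, sub_zero]
      exact_mod_cast hqi
    · have hsum : ((min s d : ℕ) : ℤ) + ((s - min s d : ℕ) : ℤ) = s := by omega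
      refine h (min s d) (by omega) (s - min s d) (by omega) (by omega)
        ((eq_iff _ _ (by omega) (by omega)).2 (Or.inr ?_))
      rw [hsum, has]
  · rintro ⟨hpow, hsq⟩
    have ne_of_lt (i j : ℕ) (hi : i ≤ d) (hji : j < i) : θ i ≠ θ j := by
      rw [Ne, eq_iff i j hi (by omega)]
      rintro (h | h)
      · refine hpow (i - j) (by omega) (by omega) ?_
        rw [← Nat.cast_sub hji.le] at h
        exact_mod_cast h
      · refine hsq (i + j) (by omega) (by omega) ?_
        rw [h, Nat.cast_add]
    intro i hi j hj hij
    rcases hij.lt_or_gt with hlt | hgt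
    · exact (ne_of_lt j i hj hlt).symm
    · exact ne_of_lt i j hi hgt
end

section
/- If (a,b,c;q) ∈ QRAC_red, then the sequence ({θ_i}_{i=0}^d; {θ*_i}_{i=0}^d; {φ_i}_{i=1}^d; {ϕ_i}_{i=1}^d) defined by the QRacah formulas is a parameter array over 𝕂 of diameter d. -/
/-- θ_i = a·q^{2i−d} + a^{−1}·q^{d−2i}. -/
noncomputable def qθ {K : Type*} [Field K] (d : ℕ) (a q : K) (i : ℕ) : K :=
  a * q ^ (2 * (i : ℤ) - (d : ℤ)) + a⁻¹ * q ^ ((d : ℤ) - 2 * (i : ℤ))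

/-- The first split sequence φ_i of QRacah type. -/
noncomputable def qφ {K : Type*} [Field K] (d : ℕ) (a b c q : K) (i : ℕ) : K :=
  a⁻¹ * b⁻¹ * q ^ ((d : ℤ) + 1) * (q ^ (i : ℤ) - q ^ (-(i : ℤ))) *
    (q ^ ((i : ℤ) - (d : ℤ) - 1) - q ^ ((d : ℤ) - (i : ℤ) + 1)) *
    (q ^ (-(i : ℤ)) - a * b * c * q ^ ((i : ℤ) - (d : ℤ) - 1)) *
    (q ^ (-(i : ℤ)) - a * b * c⁻¹ * q ^ ((i : ℤ) - (d : ℤ) - 1))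

/-- The second split sequence ϕ_i of QRacah type. -/
noncomputable def qϕ {K : Type*} [Field K] (d : ℕ) (a b c q : K) (i : ℕ) : K :=
  a * b⁻¹ * q ^ ((d : ℤ) + 1) * (q ^ (i : ℤ) - q ^ (-(i : ℤ))) *
    (q ^ ((i : ℤ) - (d : ℤ) - 1) - q ^ ((d : ℤ) - (i : ℤ) + 1)) *
    (q ^ (-(i : ℤ)) - a⁻¹ * b * c * q ^ ((i : ℤ) - (d : ℤ) - 1)) *
    (q ^ (-(i : ℤ)) - a⁻¹ * b * c⁻¹ * q ^ ((i : ℤ) - (d : ℤ) - 1))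

/-- Parameter array over 𝕂 of diameter d: conditions (PA1)–(PA5). -/
def IsParameterArray {K : Type*} [Field K] (d : ℕ) (θ θs φ ϕ : ℕ → K) : Prop :=
  (∀ i, i ≤ d → ∀ j, j ≤ d → i ≠ j → θ i ≠ θ j ∧ θs i ≠ θs j) ∧
  (∀ i, 1 ≤ i → i ≤ d → φ i ≠ 0 ∧ ϕ i ≠ 0) ∧
  (∀ i, 1 ≤ i → i ≤ d →
    φ i = ϕ 1 * (∑ h ∈ Finset.range i, (θ h - θ (d - h)) / (θ 0 - θ d)) +
      (θs i - θs 0) * (θ (i - 1) - θ d)) ∧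
  (∀ i, 1 ≤ i → i ≤ d →
    ϕ i = φ 1 * (∑ h ∈ Finset.range i, (θ h - θ (d - h)) / (θ 0 - θ d)) +
      (θs i - θs 0) * (θ (d - i + 1) - θ 0)) ∧
  (∃ β : K, ∀ i, 2 ≤ i → i + 1 ≤ d →
    (θ (i - 2) - θ (i + 1)) / (θ (i - 1) - θ i) = β ∧
    (θs (i - 2) - θs (i + 1)) / (θs (i - 1) - θs i) = β)

/-- The set QRAC_red: conditions (RQRAC1)–(RQRAC4). -/
def QRACred {K : Type*} [Field K] (d : ℕ) (a b c q : K) : Prop :=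
  (a ≠ 0 ∧ b ≠ 0 ∧ c ≠ 0 ∧ q ≠ 0) ∧
  (∀ i : ℕ, 1 ≤ i → i ≤ d → q ^ (2 * i) ≠ 1) ∧
  (∀ i : ℕ, 1 ≤ i → i ≤ 2 * d - 1 →
    a ^ 2 ≠ q ^ (2 * (d : ℤ) - 2 * (i : ℤ)) ∧ b ^ 2 ≠ q ^ (2 * (d : ℤ) - 2 * (i : ℤ))) ∧
  (∀ i : ℕ, 1 ≤ i → i ≤ d →
    a * b * c ≠ q ^ ((d : ℤ) - 2 * (i : ℤ) + 1) ∧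
    a⁻¹ * b * c ≠ q ^ ((d : ℤ) - 2 * (i : ℤ) + 1) ∧
    a * b⁻¹ * c ≠ q ^ ((d : ℤ) - 2 * (i : ℤ) + 1) ∧
    a * b * c⁻¹ ≠ q ^ ((d : ℤ) - 2 * (i : ℤ) + 1))

section QRacahFormulas

variable {K : Type*} [Field K] {d : ℕ} {a b c q : K}

theorem qθ_eq (hq : q ≠ 0) (i : ℕ) :
    qθ d a q i = a * ((q ^ i) ^ 2 / q ^ d) + a⁻¹ * (q ^ d / (q ^ i) ^ 2) := by
  simp only [qθ, zpow_sub₀ hq, mul_comm (2 : ℤ), zpow_mul, zpow_natCast, zpow_ofNat]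

theorem qθ_reflect (hq : q ≠ 0) {i : ℕ} (hi : i ≤ d) :
    qθ d a q (d - i) = a * (q ^ d / (q ^ i) ^ 2) + a⁻¹ * ((q ^ i) ^ 2 / q ^ d) := by
  obtain ⟨k, rfl⟩ := Nat.exists_eq_add_of_le hi
  rw [qθ_eq hq, Nat.add_sub_cancel_left, pow_add]
  congr 2 <;> field_simp

theorem qφ_eq (hq : q ≠ 0) (i : ℕ) :
    qφ d a b c q i = a⁻¹ * b⁻¹ * (q ^ d * q) * (q ^ i - (q ^ i)⁻¹) *
      (q ^ i / q ^ d / q - q ^ d / q ^ i * q) *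
      ((q ^ i)⁻¹ - a * b * c * (q ^ i / q ^ d / q)) *
      ((q ^ i)⁻¹ - a * b * c⁻¹ * (q ^ i / q ^ d / q)) := by
  simp only [qφ, zpow_sub₀ hq, zpow_add₀ hq, zpow_neg, zpow_natCast, zpow_one]

theorem qϕ_eq (i : ℕ) : qϕ d a b c q i = qφ d a⁻¹ b c q i := by
  simp only [qϕ, qφ, inv_inv]

theorem qθ_inv_eq_reflect (hq : q ≠ 0) {i : ℕ} (hi : i ≤ d) :
    qθ d a⁻¹ q i = qθ d a q (d - i) := by
  rw [qθ_eq hq, qθ_reflect hq hi, inv_inv]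
  ring

theorem qθ_ne (ha : a ≠ 0) (hq : q ≠ 0) (hq2 : ∀ i : ℕ, 1 ≤ i → i ≤ d → q ^ (2 * i) ≠ 1)
    (ha2 : ∀ i : ℕ, 1 ≤ i → i ≤ 2 * d - 1 → a ^ 2 ≠ q ^ (2 * (d : ℤ) - 2 * (i : ℤ)))
    {i j : ℕ} (hij : i < j) (hj : j ≤ d) : qθ d a q i ≠ qθ d a q j := by
  have h1 := ha2 (i + j) (by omega) (by omega)
  obtain ⟨k, rfl⟩ := Nat.exists_eq_add_of_lt hij
  have h2 := hq2 (k + 1) (by omega) (by omega)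
  intro h
  have hz : q ^ (2 * (d : ℤ) - 2 * ((i + (i + k + 1) : ℕ) : ℤ)) =
      (q ^ d) ^ 2 / (q ^ (i + (i + k + 1))) ^ 2 := by
    simp only [zpow_sub₀ hq, mul_comm (2 : ℤ), zpow_mul, zpow_natCast, zpow_ofNat]
  rw [hz, Ne, eq_div_iff (by positivity)] at h1
  rw [qθ_eq hq, qθ_eq hq] at h
  rw [← sub_eq_zero] at h
  have key : (q ^ (2 * (k + 1)) - 1) *
      (a ^ 2 * (q ^ (i + (i + k + 1))) ^ 2 - (q ^ d) ^ 2) = 0 := by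
    rw [← mul_zero (-(a * q ^ d * (q ^ (i + k + 1)) ^ 2)), ← h]
    field_simp
    ring
  rcases mul_eq_zero.mp key with h' | h'
  · exact h2 (sub_eq_zero.mp h')
  · exact h1 (sub_eq_zero.mp h')

theorem qφ_ne_zero (ha : a ≠ 0) (hb : b ≠ 0) (hq : q ≠ 0)
    (hq2 : ∀ i : ℕ, 1 ≤ i → i ≤ d → q ^ (2 * i) ≠ 1) {i : ℕ} (hi : 1 ≤ i) (hid : i ≤ d)
    (hc : a * b * c ≠ q ^ ((d : ℤ) - 2 * (i : ℤ) + 1))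
    (hc' : a * b * c⁻¹ ≠ q ^ ((d : ℤ) - 2 * (i : ℤ) + 1)) : qφ d a b c q i ≠ 0 := by
  have sub_ne : ∀ m n k : ℤ, ∀ x : K, x ≠ q ^ k → m = k + n → q ^ m - x * q ^ n ≠ 0 := by
    rintro m n k x hx rfl h
    rw [zpow_add₀ hq, ← sub_mul] at h
    exact hx (sub_eq_zero.mp ((mul_eq_zero.mp h).resolve_right (zpow_ne_zero _ hq))).symm
  have one_ne : ∀ j : ℕ, 1 ≤ j → j ≤ d → (1 : K) ≠ q ^ (2 * (j : ℤ)) := fun j h1 h2 h =>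
    hq2 j h1 h2 (by exact_mod_cast h.symm)
  have h1 := sub_ne i (-i) (2 * i) 1 (one_ne i hi hid) (by ring)
  have h2 := sub_ne (d - i + 1) (i - d - 1) (2 * ((d - i + 1 : ℕ) : ℤ)) 1
    (one_ne _ (by omega) (by omega)) (by omega)
  rw [one_mul] at h1 h2
  have h3 := sub_ne (-i) (i - d - 1) _ _ hc (by ring)
  have h4 := sub_ne (-i) (i - d - 1) _ _ hc' (by ring)
  rw [← neg_ne_zero, neg_sub] at h2
  exact mul_ne_zero (mul_ne_zero (mul_ne_zero (mul_ne_zero (mul_ne_zero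
    (mul_ne_zero (inv_ne_zero ha) (inv_ne_zero hb)) (zpow_ne_zero _ hq)) h1) h2) h3) h4

theorem sum_qθ_sub_reflect_div (ha : a ≠ 0) (hq : q ≠ 0) (hq1 : q ^ 2 - 1 ≠ 0)
    (hd1 : (q ^ d) ^ 2 - 1 ≠ 0) (h0 : qθ d a q 0 ≠ qθ d a q d) {i : ℕ} (hi : i ≤ d + 1) :
    ∑ h ∈ Finset.range i, (qθ d a q h - qθ d a q (d - h)) / (qθ d a q 0 - qθ d a q d) =
      ((q ^ i) ^ 2 - 1) * ((q ^ d) ^ 2 * q ^ 2 - (q ^ i) ^ 2) /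
        ((q ^ i) ^ 2 * (q ^ 2 - 1) * ((q ^ d) ^ 2 - 1)) := by
  have hden : qθ d a q 0 - qθ d a q d = (a - a⁻¹) * (1 - (q ^ d) ^ 2) / q ^ d := by
    rw [qθ_eq hq, qθ_eq hq]
    field_simp
    ring
  have hne := hden ▸ sub_ne_zero.mpr h0
  have haa : a - a⁻¹ ≠ 0 := by
    intro h
    simp [h] at hne
  have hd1' : 1 - (q ^ d) ^ 2 ≠ 0 := by rwa [← neg_ne_zero, neg_sub]
  induction i with
  | zero => simp
  | succ i ih =>
    have hterm : (qθ d a q i - qθ d a q (d - i)) / (qθ d a q 0 - qθ d a q d) =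
        ((q ^ d) ^ 2 - (q ^ i) ^ 4) / ((q ^ i) ^ 2 * ((q ^ d) ^ 2 - 1)) := by
      have hnum : qθ d a q i - qθ d a q (d - i) =
          (a - a⁻¹) * ((q ^ i) ^ 4 - (q ^ d) ^ 2) / ((q ^ i) ^ 2 * q ^ d) := by
        rw [qθ_eq hq, qθ_reflect hq (by omega)]
        field_simp
        ring
      rw [hnum, hden, div_div_div_eq, div_eq_div_iff (by positivity) (by positivity)]
      ring
    rw [Finset.sum_range_succ, ih (by omega), hterm, pow_succ]
    field_simp
    ring

theorem qφ_eq_qϕ_one_mul_sum (ha : a ≠ 0) (hb : b ≠ 0) (hc : c ≠ 0) (hq : q ≠ 0)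
    (hq1 : q ^ 2 - 1 ≠ 0) (hd1 : (q ^ d) ^ 2 - 1 ≠ 0) (h0 : qθ d a q 0 ≠ qθ d a q d)
    {i : ℕ} (hi : 1 ≤ i) (hid : i ≤ d) :
    qφ d a b c q i = qϕ d a b c q 1 *
        (∑ h ∈ Finset.range i, (qθ d a q h - qθ d a q (d - h)) / (qθ d a q 0 - qθ d a q d)) +
      (qθ d b q i - qθ d b q 0) * (qθ d a q (i - 1) - qθ d a q d) := by
  obtain ⟨k, rfl⟩ := Nat.exists_eq_add_of_le' hi
  rw [sum_qθ_sub_reflect_div ha hq hq1 hd1 h0 (by omega), qϕ_eq, qφ_eq hq, qφ_eq hq]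
  simp only [Nat.add_sub_cancel, qθ_eq hq, pow_succ q k, pow_one, pow_zero]
  have hD := pow_ne_zero d hq
  have hx := pow_ne_zero k hq
  generalize q ^ d = D at *
  generalize q ^ k = x at *
  field_simp
  ring

theorem qθ_sub_div_sub (hq : q ≠ 0) (ha : a ≠ 0) {k : ℕ}
    (hk : qθ d a q (k + 1) ≠ qθ d a q (k + 2)) :
    (qθ d a q k - qθ d a q (k + 3)) / (qθ d a q (k + 1) - qθ d a q (k + 2)) =
      (q ^ 4 + q ^ 2 + 1) / q ^ 2 := by
  rw [div_eq_iff (sub_ne_zero.mpr hk)]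
  simp only [qθ_eq hq, pow_add q k]
  field_simp
  ring

end QRacahFormulas

/-- Lemma 7.5: if (a,b,c;q) ∈ QRAC_red then the QRacah formulas define a
parameter array over 𝕂 of diameter d. -/
theorem stmt_4 {K : Type*} [Field K] [IsAlgClosed K] (d : ℕ) (hd : 3 ≤ d)
    (a b c q : K) (h : QRACred d a b c q) :
    IsParameterArray d (qθ d a q) (qθ d b q) (qφ d a b c q) (qϕ d a b c q) := by
  obtain ⟨⟨ha, hb, hc, hq⟩, hq2, hab, habc⟩ := h
  have hθa {i j : ℕ} := qθ_ne (i := i) (j := j) ha hq hq2 fun i h1 h2 => (hab i h1 h2).1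
  have hθb {i j : ℕ} := qθ_ne (i := i) (j := j) hb hq hq2 fun i h1 h2 => (hab i h1 h2).2
  have hq1 : q ^ 2 - 1 ≠ 0 := sub_ne_zero.mpr (by simpa using hq2 1 le_rfl (by omega))
  have hd1 : (q ^ d) ^ 2 - 1 ≠ 0 := sub_ne_zero.mpr (by
    rw [← pow_mul, mul_comm]
    exact hq2 d (by omega) le_rfl)
  have h0 : qθ d a q 0 ≠ qθ d a q d := hθa (by omega) le_rfl
  refine ⟨fun i hi j hj hij => ?_, fun i hi hid => ⟨?_, ?_⟩, fun i hi hid => ?_,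
    fun i hi hid => ?_, (q ^ 4 + q ^ 2 + 1) / q ^ 2, fun i hi hid => ?_⟩
  · rcases lt_or_gt_of_ne hij with h | h
    · exact ⟨hθa h hj, hθb h hj⟩
    · exact ⟨(hθa h hi).symm, (hθb h hi).symm⟩
  · obtain ⟨h1, -, -, h4⟩ := habc i hi hid
    exact qφ_ne_zero ha hb hq hq2 hi hid h1 h4
  · rw [qϕ_eq]
    refine qφ_ne_zero (inv_ne_zero ha) hb hq hq2 hi hid (habc i hi hid).2.1 fun h => ?_
    apply (habc (d + 1 - i) (by omega) (by omega)).2.2.1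
    rw [← inv_inj, ← zpow_neg, show -((d : ℤ) - 2 * ((d + 1 - i : ℕ) : ℤ) + 1) =
      (d : ℤ) - 2 * (i : ℤ) + 1 by omega, ← h]
    simp only [mul_inv, inv_inv]
  · exact qφ_eq_qϕ_one_mul_sum ha hb hc hq hq1 hd1 h0 hi hid
  · have hr : ∀ {j}, j ≤ d → qθ d a⁻¹ q j = qθ d a q (d - j) := qθ_inv_eq_reflect hq
    have h0' : qθ d a⁻¹ q 0 ≠ qθ d a⁻¹ q d := by
      simpa [hr] using h0.symm
    have key := qφ_eq_qϕ_one_mul_sum (inv_ne_zero ha) hb hc hq hq1 hd1 h0' hi hid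
    rw [sum_qθ_sub_reflect_div (inv_ne_zero ha) hq hq1 hd1 h0' (by omega), qϕ_eq, inv_inv,
      hr (by omega), hr le_rfl, Nat.sub_self, show d - (i - 1) = d - i + 1 by omega] at key
    rw [sum_qθ_sub_reflect_div ha hq hq1 hd1 h0 (by omega), qϕ_eq]
    exact key
  · obtain ⟨k, rfl⟩ := Nat.exists_eq_add_of_le' hi
    exact ⟨qθ_sub_div_sub hq ha (hθa (by omega) (by omega)),
      qθ_sub_div_sub hq hb (hθb (by omega) (by omega))⟩
end

section
/- Suppose a, b, c, q are nonzero scalars in 𝕂 with q² ≠ 1 and q² ≠ −1 such that the sequence ({θ_i}_{i=0}^d; {θ*_i}_{i=0}^d; {φ_i}_{i=1}^d; {ϕ_i}_{i=1}^d) defined by the QRacah formulas is a parameter array over 𝕂 of diameter d. Then (a,b,c;q) ∈ QRAC_red. -/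
/-- The factors of `qφ` and `qϕ` involving `c` vanish when their coefficient `x` is
`q ^ (d - 2 * i + 1)`. -/
theorem split_factor_eq_zero {K : Type*} [Field K] {q x : K} (hq : q ≠ 0) (d i : ℕ)
    (hx : x = q ^ ((d : ℤ) - 2 * (i : ℤ) + 1)) :
    q ^ (-(i : ℤ)) - x * q ^ ((i : ℤ) - (d : ℤ) - 1) = 0 := by
  rw [hx, ← zpow_add₀ hq, sub_eq_zero]
  congr 1
  ring

/-- Two of the scalars `qθ d a q i` coincide when `a ^ 2 = q ^ (2 * d - 2 * (i + j))`. -/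
theorem qθ_eq_of_sq_eq {K : Type*} [Field K] {a q : K} (ha : a ≠ 0) (hq : q ≠ 0) (d i j : ℕ)
    (h : a ^ 2 = q ^ (2 * (d : ℤ) - 2 * ((i + j : ℕ) : ℤ))) :
    qθ d a q i = qθ d a q j := by
  have swap : ∀ m n : ℕ, a ^ 2 = q ^ (2 * (d : ℤ) - 2 * ((m + n : ℕ) : ℤ)) →
      a * q ^ (2 * (m : ℤ) - (d : ℤ)) = a⁻¹ * q ^ ((d : ℤ) - 2 * (n : ℤ)) := by
    intro m n hmn
    rw [eq_inv_mul_iff_mul_eq₀ ha, ← mul_assoc, ← sq, hmn, ← zpow_add₀ hq]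
    congr 1
    push_cast
    ring
  unfold qθ
  rw [swap i j h, ← swap j i (by rwa [add_comm j i]), add_comm]

/-- If the `qθ d a q i` are distinct, then `a ^ 2` avoids the relevant even powers of `q`. -/
theorem sq_ne_zpow_of_qθ_ne {K : Type*} [Field K] {a q : K} (ha : a ≠ 0) (hq : q ≠ 0) {d : ℕ}
    (h : ∀ i, i ≤ d → ∀ j, j ≤ d → i ≠ j → qθ d a q i ≠ qθ d a q j)
    (k : ℕ) (hk1 : 1 ≤ k) (hk : k ≤ 2 * d - 1) :
    a ^ 2 ≠ q ^ (2 * (d : ℤ) - 2 * (k : ℤ)) := by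
  intro hsq
  obtain ⟨i, j, hi, hj, hij, rfl⟩ : ∃ i j, i ≤ d ∧ j ≤ d ∧ i ≠ j ∧ k = i + j := by
    rcases le_total k d with hkd | hkd
    · exact ⟨0, k, by omega, by omega, by omega, by omega⟩
    · exact ⟨k - d, d, by omega, by omega, by omega, by omega⟩
  exact h i hi j hj hij (qθ_eq_of_sq_eq ha hq d i j hsq)

/-- Lemma 7.4: if a,b,c,q are nonzero with q² ≠ ±1 and the QRacah formulas define a
parameter array over 𝕂 of diameter d, then (a,b,c;q) ∈ QRAC_red. -/
theorem stmt_5 {K : Type*} [Field K] [IsAlgClosed K] (d : ℕ) (hd : 3 ≤ d)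
    (a b c q : K) (ha : a ≠ 0) (hb : b ≠ 0) (hc : c ≠ 0) (hq : q ≠ 0)
    (hq1 : q ^ 2 ≠ 1) (hq2 : q ^ 2 ≠ -1)
    (h : IsParameterArray d (qθ d a q) (qθ d b q) (qφ d a b c q) (qϕ d a b c q)) :
    QRACred d a b c q := by
  obtain ⟨hne, hsplit, -⟩ := h
  refine ⟨⟨ha, hb, hc, hq⟩, fun i hi hid hqi => ?_, fun k hk1 hk => ⟨?_, ?_⟩,
    fun i hi hid => ⟨fun hx => ?_, fun hx => ?_, fun hx => ?_, fun hx => ?_⟩⟩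
  · apply (hsplit i hi hid).1
    have : q ^ (i : ℤ) - q ^ (-(i : ℤ)) = 0 := by
      rw [sub_eq_zero, zpow_neg, zpow_natCast, ← mul_eq_one_iff_eq_inv₀ (pow_ne_zero _ hq),
        ← pow_add, ← two_mul, hqi]
    rw [qφ, this]
    ring
  · exact sq_ne_zpow_of_qθ_ne ha hq (fun i hi j hj hij => (hne i hi j hj hij).1) k hk1 hk
  · exact sq_ne_zpow_of_qθ_ne hb hq (fun i hi j hj hij => (hne i hi j hj hij).2) k hk1 hk
  · apply (hsplit i hi hid).1
    rw [qφ, split_factor_eq_zero hq d i hx, mul_zero, zero_mul]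
  · apply (hsplit i hi hid).2
    rw [qϕ, split_factor_eq_zero hq d i hx, mul_zero, zero_mul]
  · apply (hsplit (d + 1 - i) (by omega) (by omega)).2
    have hx' : a⁻¹ * b * c⁻¹ = q ^ ((d : ℤ) - 2 * ((d + 1 - i : ℕ) : ℤ) + 1) := by
      have hinv : a⁻¹ * b * c⁻¹ = (a * b⁻¹ * c)⁻¹ := by simp only [mul_inv, inv_inv]
      rw [hinv, hx, ← zpow_neg]
      congr 1
      omega
    rw [qϕ, split_factor_eq_zero hq d _ hx', mul_zero]
  · apply (hsplit i hi hid).1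
    rw [qφ, split_factor_eq_zero hq d i hx, mul_zero]
end

section
/- For all c ∈ 𝕂 the following are equivalent: (i) c is nonzero and for all 1 ≤ i ≤ d one has φ_i = a^{−1}b^{−1}q^{d+1}(q^i − q^{−i})(q^{i−d−1} − q^{d−i+1})(q^{−i} − abc·q^{i−d−1})(q^{−i} − abc^{−1}·q^{i−d−1}) and ϕ_i = a·b^{−1}q^{d+1}(q^i − q^{−i})(q^{i−d−1} − q^{d−i+1})(q^{−i} − a^{−1}bc·q^{i−d−1})(q^{−i} − a^{−1}bc^{−1}·q^{i−d−1}); (ii) c is a root of the polynomial x² − κx + 1, where κ = a·b^{−1}q^{d−1} + a^{−1}·b·q^{1−d} + ϕ_1/((q − q^{−1})(q^d − q^{−d})). -/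
theorem qθ_reverse {K : Type*} [Field K] {d i : ℕ} (a q : K) (hi : i ≤ d) :
    qθ d a q (d - i) = qθ d a⁻¹ q i := by
  unfold qθ
  rw [Nat.cast_sub hi, inv_inv, add_comm]
  congr 3 <;> ring

theorem qϕ_eq_qφ_inv {K : Type*} [Field K] (d : ℕ) (a b c q : K) (i : ℕ) :
    qϕ d a b c q i = qφ d a⁻¹ b c q i := by
  simp only [qϕ, qφ, inv_inv]

theorem qφ_eq_qϕ_inv {K : Type*} [Field K] (d : ℕ) (a b c q : K) (i : ℕ) :
    qφ d a b c q i = qϕ d a⁻¹ b c q i := by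
  simp only [qϕ, qφ, inv_inv]

/-- The closed form of the sum `∑_{h < i} (θ_h - θ_{d-h}) / (θ_0 - θ_d)`. -/
noncomputable def qϑ {K : Type*} [Field K] (d : ℕ) (q : K) (i : ℕ) : K :=
  (q ^ (i : ℤ) - q ^ (-(i : ℤ))) * (q ^ ((d : ℤ) - i + 1) - q ^ ((i : ℤ) - d - 1)) /
    ((q - q⁻¹) * (q ^ (d : ℤ) - q ^ (-(d : ℤ))))

theorem qθ_sub_qθ_reverse {K : Type*} [Field K] {d h : ℕ} (a q : K) (hh : h ≤ d) :
    qθ d a q h - qθ d a q (d - h) =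
      (a⁻¹ - a) * (q ^ ((d : ℤ) - 2 * h) - q ^ (2 * (h : ℤ) - d)) := by
  rw [qθ_reverse a q hh]
  simp only [qθ, inv_inv]
  ring

theorem qθ_zero_sub_qθ_self {K : Type*} [Field K] (d : ℕ) (a q : K) :
    qθ d a q 0 - qθ d a q d = (a⁻¹ - a) * (q ^ (d : ℤ) - q ^ (-(d : ℤ))) := by
  simpa using qθ_sub_qθ_reverse a q (Nat.zero_le d)

theorem sum_qθ_sub_div {K : Type*} [Field K] {d : ℕ} {a q : K} (hq : q ≠ 0)
    (hq1 : q - q⁻¹ ≠ 0) (h0 : qθ d a q 0 ≠ qθ d a q d) {i : ℕ} (hi : i ≤ d) :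
    ∑ h ∈ Finset.range i, (qθ d a q h - qθ d a q (d - h)) / (qθ d a q 0 - qθ d a q d) =
      qϑ d q i := by
  have hne := sub_ne_zero.mpr h0
  rw [qθ_zero_sub_qθ_self] at hne
  have ha := left_ne_zero_of_mul hne
  induction i with
  | zero => simp [qϑ]
  | succ n ih =>
    rw [Finset.sum_range_succ, ih (by omega), qθ_sub_qθ_reverse a q (by omega),
      qθ_zero_sub_qθ_self, mul_div_mul_left _ _ ha, qϑ, qϑ,
      ← mul_div_mul_left (_ - _) _ hq1, ← add_div]
    congr 1
    push_cast
    simp only [two_mul, neg_add, sub_eq_add_neg, zpow_add₀ hq, zpow_neg, zpow_one]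
    have hQ : q ^ (n : ℤ) ≠ 0 := zpow_ne_zero _ hq
    have hD : q ^ (d : ℤ) ≠ 0 := zpow_ne_zero _ hq
    generalize q ^ (n : ℤ) = Q at *
    generalize q ^ (d : ℤ) = D at *
    field_simp
    ring

theorem qϕ_one {K : Type*} [Field K] (d : ℕ) {a b c q : K} (ha : a ≠ 0) (hb : b ≠ 0)
    (hc : c ≠ 0) (hq : q ≠ 0) :
    qϕ d a b c q 1 = (q - q⁻¹) * (q ^ (d : ℤ) - q ^ (-(d : ℤ))) *
      (c + c⁻¹ - (a * b⁻¹ * q ^ ((d : ℤ) - 1) + a⁻¹ * b * q ^ (1 - (d : ℤ)))) := by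
  unfold qϕ
  push_cast
  simp only [neg_add, sub_eq_add_neg, zpow_add₀ hq, zpow_neg, zpow_one]
  have hD : q ^ (d : ℤ) ≠ 0 := zpow_ne_zero _ hq
  generalize q ^ (d : ℤ) = D at *
  field_simp
  ring

theorem qφ_eq_s6 {K : Type*} [Field K] {d : ℕ} {a b c q : K} (ha : a ≠ 0) (hb : b ≠ 0)
    (hc : c ≠ 0) (hq : q ≠ 0) (hq1 : q - q⁻¹ ≠ 0)
    (hqd : q ^ (d : ℤ) - q ^ (-(d : ℤ)) ≠ 0) {i : ℕ} (hi : 1 ≤ i) :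
    qφ d a b c q i = qϕ d a b c q 1 * qϑ d q i +
      (qθ d b q i - qθ d b q 0) * (qθ d a q (i - 1) - qθ d a q d) := by
  rw [qϕ_one d ha hb hc hq, qϑ, mul_right_comm, mul_div_cancel₀ _ (mul_ne_zero hq1 hqd)]
  unfold qφ qθ
  push_cast [Nat.cast_sub hi]
  simp only [two_mul, neg_add, sub_eq_add_neg, zpow_add₀ hq, zpow_neg, neg_neg,
    zpow_one, zpow_zero]
  have hQ : q ^ (i : ℤ) ≠ 0 := zpow_ne_zero _ hq
  have hD : q ^ (d : ℤ) ≠ 0 := zpow_ne_zero _ hq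
  generalize q ^ (i : ℤ) = Q at *
  generalize q ^ (d : ℤ) = D at *
  field_simp
  ring

theorem qϕ_eq_s6 {K : Type*} [Field K] {d : ℕ} {a b c q : K} (ha : a ≠ 0) (hb : b ≠ 0)
    (hc : c ≠ 0) (hq : q ≠ 0) (hq1 : q - q⁻¹ ≠ 0)
    (hqd : q ^ (d : ℤ) - q ^ (-(d : ℤ)) ≠ 0) {i : ℕ} (hi : 1 ≤ i) (hid : i ≤ d) :
    qϕ d a b c q i = qφ d a b c q 1 * qϑ d q i +
      (qθ d b q i - qθ d b q 0) * (qθ d a q (d - i + 1) - qθ d a q 0) := by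
  rw [qϕ_eq_qφ_inv, qφ_eq_s6 (inv_ne_zero ha) hb hc hq hq1 hqd hi, ← qφ_eq_qϕ_inv,
    ← qθ_reverse a q (by omega : i - 1 ≤ d), ← qθ_reverse a q le_rfl, Nat.sub_self,
    show d - (i - 1) = d - i + 1 by omega]

/-- Lemma 6.3: for a parameter array of QRacah type, c satisfies the split-sequence
formulas iff c is a root of x² − κx + 1. -/
theorem stmt_6 {K : Type*} [Field K] [IsAlgClosed K] (d : ℕ) (hd : 3 ≤ d)
    (θ θs φ ϕ : ℕ → K) (hPA : IsParameterArray d θ θs φ ϕ)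
    (a b q : K) (ha : a ≠ 0) (hb : b ≠ 0) (hq : q ≠ 0)
    (hq1 : q ^ 2 ≠ 1) (hq2 : q ^ 2 ≠ -1)
    (hθ : ∀ i, i ≤ d → θ i = qθ d a q i)
    (hθs : ∀ i, i ≤ d → θs i = qθ d b q i) :
    ∀ c : K,
      (c ≠ 0 ∧ ∀ i, 1 ≤ i → i ≤ d → φ i = qφ d a b c q i ∧ ϕ i = qϕ d a b c q i) ↔
      c ^ 2 - (a * b⁻¹ * q ^ ((d : ℤ) - 1) + a⁻¹ * b * q ^ (1 - (d : ℤ)) +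
          ϕ 1 / ((q - q⁻¹) * (q ^ (d : ℤ) - q ^ (-(d : ℤ))))) * c + 1 = 0 := by
  obtain ⟨hne, -, hφ, hϕ, -⟩ := hPA
  have hq' : q - q⁻¹ ≠ 0 := by
    intro h
    apply hq1
    rw [sq]
    nth_rewrite 2 [sub_eq_zero.mp h]
    exact mul_inv_cancel₀ hq
  have h0 : qθ d a q 0 ≠ qθ d a q d := by
    rw [← hθ 0 (Nat.zero_le d), ← hθ d le_rfl]
    exact (hne 0 (Nat.zero_le d) d le_rfl (by omega)).1
  have hqd : q ^ (d : ℤ) - q ^ (-(d : ℤ)) ≠ 0 := by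
    intro h
    apply h0
    rw [← sub_eq_zero, qθ_zero_sub_qθ_self, h, mul_zero]
  have hsum (i : ℕ) (hid : i ≤ d) :
      ∑ h ∈ Finset.range i, (θ h - θ (d - h)) / (θ 0 - θ d) = qϑ d q i := by
    rw [← sum_qθ_sub_div hq hq' h0 hid]
    refine Finset.sum_congr rfl fun h hh => ?_
    have := Finset.mem_range.mp hh
    rw [hθ h (by omega), hθ (d - h) (by omega), hθ 0 (by omega), hθ d le_rfl]
  have hP := mul_ne_zero hq' hqd
  intro c
  have hroot (hc : c ≠ 0) : ϕ 1 = qϕ d a b c q 1 ↔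
      c ^ 2 - (a * b⁻¹ * q ^ ((d : ℤ) - 1) + a⁻¹ * b * q ^ (1 - (d : ℤ)) +
          ϕ 1 / ((q - q⁻¹) * (q ^ (d : ℤ) - q ^ (-(d : ℤ))))) * c + 1 = 0 := by
    rw [qϕ_one d ha hb hc hq, mul_comm, ← div_eq_iff hP]
    generalize ϕ 1 / _ = x
    generalize a * b⁻¹ * q ^ ((d : ℤ) - 1) + a⁻¹ * b * q ^ (1 - (d : ℤ)) = y
    constructor
    · rintro rfl
      field_simp
      ring
    · intro h
      field_simp
      linear_combination -h
  constructor
  · rintro ⟨hc, h⟩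
    exact (hroot hc).mp (h 1 le_rfl (by omega)).2
  · intro h
    have hc : c ≠ 0 := by
      rintro rfl
      simp at h
    have hϕ1 := (hroot hc).mpr h
    have hφc (i : ℕ) (hi : 1 ≤ i) (hid : i ≤ d) : φ i = qφ d a b c q i := by
      rw [hφ i hi hid, hsum i hid, hϕ1, hθs i hid, hθs 0 (by omega), hθ (i - 1) (by omega),
        hθ d le_rfl, qφ_eq_s6 ha hb hc hq hq' hqd hi]
    refine ⟨hc, fun i hi hid => ⟨hφc i hi hid, ?_⟩⟩
    rw [hϕ i hi hid, hsum i hid, hφc 1 le_rfl (by omega), hθs i hid, hθs 0 (by omega),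
      hθ (d - i + 1) (by omega), hθ 0 (by omega), qϕ_eq_s6 ha hb hc hq hq' hqd hi hid]
end

section
/- Let (a,b,c;q) ∈ QRAC_red. A 4-tuple (x,y,z;t) ∈ QRAC_red produces via the QRacah formulas the same four sequences ({θ_i}_{i=0}^d; {θ*_i}_{i=0}^d; {φ_i}_{i=1}^d; {ϕ_i}_{i=1}^d) as (a,b,c;q) does if and only if (x,y,z;t) is one of the following eight tuples: (a,b,c;q), (a,b,c^{−1};q), (a^{−1},b^{−1},c^{−1};q^{−1}), (a^{−1},b^{−1},c;q^{−1}), ((−1)^d a,(−1)^d b,(−1)^{d+1} c;−q), ((−1)^d a,(−1)^d b,(−1)^{d+1} c^{−1};−q), ((−1)^d a^{−1},(−1)^d b^{−1},(−1)^{d+1} c^{−1};−q^{−1}), ((−1)^d a^{−1},(−1)^d b^{−1},(−1)^{d+1} c;−q^{−1}); moreover each of these eight tuples lies in QRAC_red. -/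
section Invariance

variable {K : Type*} [Field K]

theorem qϕ_eq_qφ (d : ℕ) (a b c q : K) (i : ℕ) : qϕ d a b c q i = qφ d a⁻¹ b c q i := by
  simp only [qϕ, qφ, inv_inv]

theorem qφ_inv_c (d : ℕ) (a b c q : K) (i : ℕ) : qφ d a b c⁻¹ q i = qφ d a b c q i := by
  simp only [qφ, inv_inv]
  ring

theorem qθ_inv (d : ℕ) (a q : K) (i : ℕ) : qθ d a⁻¹ q⁻¹ i = qθ d a q i := by
  simp only [qθ, inv_inv, inv_zpow', neg_sub]
  ring

theorem qφ_inv (d : ℕ) {a b c q : K} (ha : a ≠ 0) (hb : b ≠ 0) (hc : c ≠ 0) (hq : q ≠ 0) (i : ℕ) :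
    qφ d a⁻¹ b⁻¹ c q⁻¹ i = qφ d a b c q i := by
  simp only [qφ, inv_zpow, zpow_sub₀ hq, zpow_add₀ hq, zpow_neg, zpow_natCast, inv_pow,
    inv_inv, zpow_one]
  have hqd : q ^ d ≠ 0 := pow_ne_zero d hq
  have hqi : q ^ i ≠ 0 := pow_ne_zero i hq
  generalize q ^ d = u at *
  generalize q ^ i = v at *
  field_simp
  ring

theorem qθ_neg (d : ℕ) {q : K} (hq : q ≠ 0) (a : K) (i : ℕ) :
    qθ d ((-1) ^ d * a) (-q) i = qθ d a q i := by
  have hq' : -q ≠ 0 := neg_ne_zero.mpr hq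
  simp only [qθ, zpow_sub₀ hq, zpow_sub₀ hq', zpow_mul, zpow_natCast, zpow_ofNat, neg_sq,
    neg_pow q d, mul_inv]
  rcases neg_one_pow_eq_or K d with h | h <;> simp only [h] <;> field_simp

theorem qφ_neg (d : ℕ) {q : K} (hq : q ≠ 0) (a b c : K) (i : ℕ) :
    qφ d ((-1) ^ d * a) ((-1) ^ d * b) ((-1) ^ (d + 1) * c) (-q) i = qφ d a b c q i := by
  have hq' : -q ≠ 0 := neg_ne_zero.mpr hq
  simp only [qφ, zpow_sub₀ hq, zpow_sub₀ hq', zpow_add₀ hq, zpow_add₀ hq', zpow_neg, zpow_natCast,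
    zpow_one, neg_pow q d, neg_pow q i, mul_inv, pow_succ]
  rcases neg_one_pow_eq_or K d with h | h <;> rcases neg_one_pow_eq_or K i with h' | h' <;>
    simp only [h, h', inv_one, inv_neg] <;> ring

theorem neg_one_pow_mul_inv (n : ℕ) (a : K) : ((-1) ^ n * a)⁻¹ = (-1) ^ n * a⁻¹ := by
  rw [mul_inv, ← inv_pow, inv_neg_one]

theorem QRACred.inv_c {d : ℕ} {a b c q : K} (h : QRACred d a b c q) : QRACred d a b c⁻¹ q := by
  obtain ⟨⟨ha, hb, hc, hq⟩, h2, h3, h4⟩ := h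
  refine ⟨⟨ha, hb, inv_ne_zero hc, hq⟩, h2, h3, fun i hi hid => ?_⟩
  obtain ⟨k, rfl⟩ := Nat.exists_eq_add_of_le hid
  obtain ⟨e1, -, -, e4⟩ := h4 i hi hid
  obtain ⟨-, f2, f3, -⟩ := h4 (k + 1) (by omega) (by omega)
  have hk : q ^ (((i + k : ℕ) : ℤ) - 2 * ((k + 1 : ℕ) : ℤ) + 1)
      = (q ^ (((i + k : ℕ) : ℤ) - 2 * (i : ℤ) + 1))⁻¹ := by
    rw [← zpow_neg]; congr 1; push_cast; ring
  rw [hk] at f2 f3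
  refine ⟨e4, fun e => f3 ?_, fun e => f2 ?_, by rwa [inv_inv]⟩
  all_goals
    rw [← e]
    simp only [mul_inv, inv_inv]

theorem QRACred.inv {d : ℕ} {a b c q : K} (h : QRACred d a b c q) :
    QRACred d a⁻¹ b⁻¹ c⁻¹ q⁻¹ := by
  obtain ⟨⟨ha, hb, hc, hq⟩, h2, h3, h4⟩ := h
  refine ⟨⟨inv_ne_zero ha, inv_ne_zero hb, inv_ne_zero hc, inv_ne_zero hq⟩, ?_, ?_, ?_⟩
  · simpa only [inv_pow, ne_eq, inv_eq_one] using h2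
  · simpa only [inv_pow, inv_zpow, ne_eq, inv_inj] using h3
  · simpa only [inv_zpow, ne_eq, ← mul_inv, inv_inj] using h4

theorem QRACred.neg {d : ℕ} {a b c q : K} (h : QRACred d a b c q) :
    QRACred d ((-1) ^ d * a) ((-1) ^ d * b) ((-1) ^ (d + 1) * c) (-q) := by
  obtain ⟨⟨ha, hb, hc, hq⟩, h2, h3, h4⟩ := h
  have hq' : -q ≠ 0 := neg_ne_zero.mpr hq
  refine ⟨by simp [ha, hb, hc, hq], fun i => ?_, fun i => ?_, fun i => ?_⟩
  · simpa only [pow_mul, neg_sq] using h2 i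
  · have := h3 i
    rw [← mul_sub, zpow_mul, zpow_ofNat] at this ⊢
    rcases neg_one_pow_eq_or K d with h | h <;>
      simpa only [h, one_mul, neg_one_mul, neg_sq] using this
  · have := h4 i
    simp only [neg_one_pow_mul_inv, zpow_sub₀ hq, zpow_sub₀ hq', zpow_add₀ hq, zpow_add₀ hq',
      zpow_mul, zpow_natCast, zpow_ofNat, pow_one, neg_sq, neg_pow q d, pow_succ (-1 : K)] at this ⊢
    rcases neg_one_pow_eq_or K d with h | h <;> simpa [h, neg_div] using this

/-- Two tuples with the same `q` and the same eigenvalue sequence have the same `a`. -/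
theorem eq_of_qθ_eq {d : ℕ} {a x q : K} (hd : 1 ≤ d) (hq : q ≠ 0) (hq4 : q ^ 4 ≠ 1)
    (h : ∀ i, i ≤ d → qθ d x q i = qθ d a q i) : x = a := by
  have h0 := h 0 (by omega)
  have h1 := h 1 hd
  simp only [qθ, zpow_sub₀ hq, zpow_mul, zpow_natCast, zpow_ofNat, Nat.cast_zero, Nat.cast_one,
    pow_zero] at h0 h1
  have key : (1 - q ^ 4) * (q ^ d)⁻¹ * (x - a) = 0 := by
    linear_combination h0 - q ^ 2 * h1 +
      (x⁻¹ - a⁻¹) * q ^ d * (mul_inv_cancel₀ (pow_ne_zero 2 hq))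
  have h1q : 1 - q ^ 4 ≠ 0 := sub_ne_zero.mpr hq4.symm
  simpa [h1q, hq, sub_eq_zero] using key

theorem eq_or_eq_inv_of_add_inv_eq {x y : K} (hx : x ≠ 0) (hy : y ≠ 0)
    (h : x + x⁻¹ = y + y⁻¹) : x = y ∨ x = y⁻¹ := by
  have : (x - y) * (x - y⁻¹) = 0 := by
    linear_combination x * h - mul_inv_cancel₀ hx + mul_inv_cancel₀ hy
  simpa [sub_eq_zero] using this

theorem eq_or_eq_inv_of_qφ_eq {d : ℕ} {a b c z q : K} (hd : 1 ≤ d) (h : QRACred d a b c q)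
    (hz : z ≠ 0) (e : qφ d a b z q 1 = qφ d a b c q 1) : z = c ∨ z = c⁻¹ := by
  obtain ⟨⟨ha, hb, hc, hq⟩, h2, -, -⟩ := h
  refine eq_or_eq_inv_of_add_inv_eq hz hc ?_
  have h1 : q ^ 2 - 1 ≠ 0 := sub_ne_zero.mpr (h2 1 le_rfl hd)
  have hd1 : (q ^ d) ^ 2 - 1 ≠ 0 := by
    rw [← pow_mul, mul_comm d]
    exact sub_ne_zero.mpr (h2 d hd le_rfl)
  have hqd : q ^ d ≠ 0 := pow_ne_zero d hq
  have key : qφ d a b z q 1 - qφ d a b c q 1 =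
      (q ^ 2 - 1) * ((q ^ d) ^ 2 - 1) * (q⁻¹ * (q ^ d)⁻¹) * ((z + z⁻¹) - (c + c⁻¹)) := by
    simp only [qφ, zpow_sub₀ hq, zpow_add₀ hq, zpow_neg, zpow_natCast, Nat.cast_one, zpow_one]
    clear h1 hd1
    generalize q ^ d = u at *
    field_simp
    ring
  rw [e, sub_self, eq_comm] at key
  simpa [h1, hd1, hq, sub_eq_zero] using key

/-- The eigenvalue sequence determines `q` up to sign and inversion. -/
theorem base_eq_of_qθ_eq {d : ℕ} {a x q t : K} (hd : 3 ≤ d) (ha : a ≠ 0) (hq : q ≠ 0) (ht : t ≠ 0)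
    (hq2 : q ^ 2 ≠ 1) (haq : a ^ 2 ≠ q ^ (2 * (d : ℤ) - 2 * ((3 : ℕ) : ℤ)))
    (h : ∀ i, i ≤ d → qθ d x t i = qθ d a q i) : t = q ∨ t = -q ∨ t = q⁻¹ ∨ t = -q⁻¹ := by
  have recurrence : ∀ a q : K, q ≠ 0 → qθ d a q 0 - qθ d a q 3
      = (q ^ 2 + 1 + (q ^ 2)⁻¹) * (qθ d a q 1 - qθ d a q 2) := by
    intro a q hq
    simp only [qθ, zpow_sub₀ hq, zpow_mul, zpow_natCast, zpow_ofNat, Nat.cast_zero, Nat.cast_one,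
      Nat.cast_ofNat, pow_zero]
    field_simp
    ring
  have hne : qθ d a q 1 - qθ d a q 2 ≠ 0 := by
    have hfac : qθ d a q 1 - qθ d a q 2 = (1 - q ^ 2) * a⁻¹ * q ^ (2 - (d : ℤ)) *
        (a ^ 2 - q ^ (2 * (d : ℤ) - 2 * ((3 : ℕ) : ℤ))) := by
      simp only [qθ, zpow_sub₀ hq, zpow_mul, zpow_natCast, zpow_ofNat, Nat.cast_one,
        Nat.cast_ofNat]
      field_simp
      ring
    rw [hfac]
    exact mul_ne_zero (mul_ne_zero (mul_ne_zero (sub_ne_zero.mpr hq2.symm) (inv_ne_zero ha))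
      (zpow_ne_zero _ hq)) (sub_ne_zero.mpr haq)
  have hx := recurrence x t ht
  rw [h 0 (by omega), h 1 (by omega), h 2 (by omega), h 3 hd, recurrence a q hq] at hx
  have hadd : t ^ 2 + (t ^ 2)⁻¹ = q ^ 2 + (q ^ 2)⁻¹ := by
    linear_combination -mul_right_cancel₀ hne hx
  rcases eq_or_eq_inv_of_add_inv_eq (pow_ne_zero 2 ht) (pow_ne_zero 2 hq) hadd with e | e
  · rcases sq_eq_sq_iff_eq_or_eq_neg.mp e with e | e <;> simp [e]
  · rw [← inv_pow] at e
    rcases sq_eq_sq_iff_eq_or_eq_neg.mp e with e | e <;> simp [e]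

/-- Tuples sharing `q` and producing the same sequences agree up to inverting `c`. -/
theorem eq_of_same_base {d : ℕ} {a b c q x y z : K} (hd : 3 ≤ d) (h : QRACred d a b c q)
    (hz : z ≠ 0) (hθ : ∀ i, i ≤ d → qθ d x q i = qθ d a q i)
    (hθs : ∀ i, i ≤ d → qθ d y q i = qθ d b q i) (hφ : qφ d x y z q 1 = qφ d a b c q 1) :
    x = a ∧ y = b ∧ (z = c ∨ z = c⁻¹) := by
  have hq4 : q ^ 4 ≠ 1 := h.2.1 2 (by omega) (by omega)
  obtain rfl := eq_of_qθ_eq (by omega) h.1.2.2.2 hq4 hθ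
  obtain rfl := eq_of_qθ_eq (by omega) h.1.2.2.2 hq4 hθs
  exact ⟨rfl, rfl, eq_or_eq_inv_of_qφ_eq (by omega) h hz hφ⟩

theorem qϕ_inv_c (d : ℕ) (a b c q : K) (i : ℕ) : qϕ d a b c⁻¹ q i = qϕ d a b c q i := by
  simp only [qϕ_eq_qφ, qφ_inv_c]

theorem qϕ_inv (d : ℕ) {a b c q : K} (ha : a ≠ 0) (hb : b ≠ 0) (hc : c ≠ 0) (hq : q ≠ 0) (i : ℕ) :
    qϕ d a⁻¹ b⁻¹ c q⁻¹ i = qϕ d a b c q i := by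
  rw [qϕ_eq_qφ, qϕ_eq_qφ, qφ_inv d (inv_ne_zero ha) hb hc hq]

theorem qϕ_neg (d : ℕ) {q : K} (hq : q ≠ 0) (a b c : K) (i : ℕ) :
    qϕ d ((-1) ^ d * a) ((-1) ^ d * b) ((-1) ^ (d + 1) * c) (-q) i = qϕ d a b c q i := by
  rw [qϕ_eq_qφ, qϕ_eq_qφ, neg_one_pow_mul_inv, qφ_neg d hq]

end Invariance

/-- Lemma 7.8 / Lemma 7.9: the elements of QRAC_red producing the same parameter
array as (a,b,c;q) are exactly the eight listed tuples, and each of them lies in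
QRAC_red. -/
theorem stmt_8 {K : Type*} [Field K] [IsAlgClosed K] (d : ℕ) (hd : 3 ≤ d)
    (a b c q : K) (h : QRACred d a b c q) :
    (∀ x y z t : K,
      (QRACred d x y z t ∧
        (∀ i, i ≤ d → qθ d x t i = qθ d a q i) ∧
        (∀ i, i ≤ d → qθ d y t i = qθ d b q i) ∧
        (∀ i, 1 ≤ i → i ≤ d → qφ d x y z t i = qφ d a b c q i) ∧
        (∀ i, 1 ≤ i → i ≤ d → qϕ d x y z t i = qϕ d a b c q i)) ↔
      ((x, y, z, t) = (a, b, c, q) ∨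
       (x, y, z, t) = (a, b, c⁻¹, q) ∨
       (x, y, z, t) = (a⁻¹, b⁻¹, c⁻¹, q⁻¹) ∨
       (x, y, z, t) = (a⁻¹, b⁻¹, c, q⁻¹) ∨
       (x, y, z, t) = ((-1) ^ d * a, (-1) ^ d * b, (-1) ^ (d + 1) * c, -q) ∨
       (x, y, z, t) = ((-1) ^ d * a, (-1) ^ d * b, (-1) ^ (d + 1) * c⁻¹, -q) ∨
       (x, y, z, t) = ((-1) ^ d * a⁻¹, (-1) ^ d * b⁻¹, (-1) ^ (d + 1) * c⁻¹, -q⁻¹) ∨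
       (x, y, z, t) = ((-1) ^ d * a⁻¹, (-1) ^ d * b⁻¹, (-1) ^ (d + 1) * c, -q⁻¹))) ∧
    (QRACred d a b c q ∧
     QRACred d a b c⁻¹ q ∧
     QRACred d a⁻¹ b⁻¹ c⁻¹ q⁻¹ ∧
     QRACred d a⁻¹ b⁻¹ c q⁻¹ ∧
     QRACred d ((-1) ^ d * a) ((-1) ^ d * b) ((-1) ^ (d + 1) * c) (-q) ∧
     QRACred d ((-1) ^ d * a) ((-1) ^ d * b) ((-1) ^ (d + 1) * c⁻¹) (-q) ∧
     QRACred d ((-1) ^ d * a⁻¹) ((-1) ^ d * b⁻¹) ((-1) ^ (d + 1) * c⁻¹) (-q⁻¹) ∧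
     QRACred d ((-1) ^ d * a⁻¹) ((-1) ^ d * b⁻¹) ((-1) ^ (d + 1) * c) (-q⁻¹)) := by
  have hq := h.1.2.2.2
  have ha := h.1.1
  have hb := h.1.2.1
  have hc := h.1.2.2.1
  have h' := h.inv_c
  have hi := h.inv
  have hi' : QRACred d a⁻¹ b⁻¹ c q⁻¹ := by simpa using h'.inv
  have hn := h.neg
  have hn' := h'.neg
  have hin := hi.neg
  have hin' := hi'.neg
  refine ⟨fun x y z t => ⟨?_, ?_⟩, h, h', hi, hi', hn, hn', hin, hin'⟩
  · rintro ⟨hx, hθ, hθs, hφ, -⟩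
    have hz := hx.1.2.2.1
    have hφ1 := hφ 1 le_rfl (by omega)
    simp only [Prod.mk.injEq]
    rcases base_eq_of_qθ_eq hd ha hq hx.1.2.2.2 (h.2.1 1 le_rfl (by omega))
      (h.2.2.1 3 (by omega) (by omega)).1 hθ with rfl | rfl | rfl | rfl
    · obtain ⟨rfl, rfl, rfl | rfl⟩ := eq_of_same_base hd h hz hθ hθs hφ1 <;> simp
    · obtain ⟨rfl, rfl, rfl | rfl⟩ := eq_of_same_base hd hn hz
        (by simpa only [qθ_neg d hq] using hθ) (by simpa only [qθ_neg d hq] using hθs)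
        (by rw [hφ1, qφ_neg d hq]) <;>
        simp only [neg_one_pow_mul_inv, true_and, and_true, true_or, or_true]
    · obtain ⟨rfl, rfl, rfl | rfl⟩ := eq_of_same_base hd hi' hz
        (by simpa only [qθ_inv] using hθ) (by simpa only [qθ_inv] using hθs)
        (by rw [hφ1, qφ_inv d ha hb hc hq]) <;> simp only [true_and, and_true, true_or, or_true]
    · have hq' := inv_ne_zero hq
      obtain ⟨rfl, rfl, rfl | rfl⟩ := eq_of_same_base hd hin' hz
        (by simpa only [qθ_neg d hq', qθ_inv] using hθ)
        (by simpa only [qθ_neg d hq', qθ_inv] using hθs)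
        (by rw [hφ1, qφ_neg d hq', qφ_inv d ha hb hc hq]) <;>
        simp only [neg_one_pow_mul_inv, true_and, and_true, true_or, or_true]
  · simp only [Prod.mk.injEq]
    rintro (⟨rfl, rfl, rfl, rfl⟩ | ⟨rfl, rfl, rfl, rfl⟩ | ⟨rfl, rfl, rfl, rfl⟩ |
      ⟨rfl, rfl, rfl, rfl⟩ | ⟨rfl, rfl, rfl, rfl⟩ | ⟨rfl, rfl, rfl, rfl⟩ | ⟨rfl, rfl, rfl, rfl⟩ |
      ⟨rfl, rfl, rfl, rfl⟩) <;>
    exact ⟨by assumption, by simp [qθ_neg, qθ_inv, hq], by simp [qθ_neg, qθ_inv, hq],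
      by simp [qφ_neg, qφ_inv, qφ_inv_c, ha, hb, hc, hq],
      by simp [qϕ_neg, qϕ_inv, qϕ_inv_c, ha, hb, hc, hq]⟩
end

section
/- The matrix A^ε is the unique matrix X ∈ Mat_{d+1}(𝕂) satisfying the three ℤ₃-symmetric Askey–Wilson relations: (q·A*X − q^{−1}·XA*)/(q² − q^{−2}) + A = ((b+b^{−1})(c+c^{−1}) + (a+a^{−1})(q^{d+1}+q^{−d−1}))/(q+q^{−1}) · I; (q·XA − q^{−1}·AX)/(q² − q^{−2}) + A* = ((c+c^{−1})(a+a^{−1}) + (b+b^{−1})(q^{d+1}+q^{−d−1}))/(q+q^{−1}) · I; and (q·AA* − q^{−1}·A*A)/(q² − q^{−2}) + X = ((a+a^{−1})(b+b^{−1}) + (c+c^{−1})(q^{d+1}+q^{−d−1}))/(q+q^{−1}) · I. -/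
/-- The lower bidiagonal matrix A with A_{ii} = θ_i and A_{i,i−1} = 1. -/
noncomputable def matA {K : Type*} [Field K] (d : ℕ) (a q : K) :
    Matrix (Fin (d + 1)) (Fin (d + 1)) K :=
  Matrix.of fun i j =>
    if (i : ℕ) = (j : ℕ) then qθ d a q (i : ℕ)
    else if (i : ℕ) = (j : ℕ) + 1 then 1 else 0

/-- The upper bidiagonal matrix A* with A*_{ii} = θ*_i and A*_{i−1,i} = φ_i. -/
noncomputable def matAs {K : Type*} [Field K] (d : ℕ) (a b c q : K) :
    Matrix (Fin (d + 1)) (Fin (d + 1)) K :=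
  Matrix.of fun i j =>
    if (i : ℕ) = (j : ℕ) then qθ d b q (i : ℕ)
    else if (j : ℕ) = (i : ℕ) + 1 then qφ d a b c q (j : ℕ) else 0

/-- A^ε = (q^{−1}·A*A − q·AA*)/(q²−q^{−2})
      + ((a+a^{−1})(b+b^{−1}) + (c+c^{−1})(q^{d+1}+q^{−d−1}))/(q+q^{−1}) · I. -/
noncomputable def matAe {K : Type*} [Field K] (d : ℕ) (a b c q : K) :
    Matrix (Fin (d + 1)) (Fin (d + 1)) K :=
  (q ^ 2 - q ^ (-2 : ℤ))⁻¹ •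
      (q⁻¹ • (matAs d a b c q * matA d a q) - q • (matA d a q * matAs d a b c q)) +
    (((a + a⁻¹) * (b + b⁻¹) + (c + c⁻¹) * (q ^ ((d : ℤ) + 1) + q ^ (-(d : ℤ) - 1))) /
        (q + q⁻¹)) • (1 : Matrix (Fin (d + 1)) (Fin (d + 1)) K)

/-- The ℤ₃-symmetric Askey–Wilson relations for a matrix X (with respect to A, A*). -/
def Z3AW {K : Type*} [Field K] (d : ℕ) (a b c q : K)
    (X : Matrix (Fin (d + 1)) (Fin (d + 1)) K) : Prop :=
  ((q ^ 2 - q ^ (-2 : ℤ))⁻¹ •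
      (q • (matAs d a b c q * X) - q⁻¹ • (X * matAs d a b c q)) + matA d a q =
    (((b + b⁻¹) * (c + c⁻¹) + (a + a⁻¹) * (q ^ ((d : ℤ) + 1) + q ^ (-(d : ℤ) - 1))) /
        (q + q⁻¹)) • (1 : Matrix (Fin (d + 1)) (Fin (d + 1)) K)) ∧
  ((q ^ 2 - q ^ (-2 : ℤ))⁻¹ •
      (q • (X * matA d a q) - q⁻¹ • (matA d a q * X)) + matAs d a b c q =
    (((c + c⁻¹) * (a + a⁻¹) + (b + b⁻¹) * (q ^ ((d : ℤ) + 1) + q ^ (-(d : ℤ) - 1))) /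
        (q + q⁻¹)) • (1 : Matrix (Fin (d + 1)) (Fin (d + 1)) K)) ∧
  ((q ^ 2 - q ^ (-2 : ℤ))⁻¹ •
      (q • (matA d a q * matAs d a b c q) - q⁻¹ • (matAs d a b c q * matA d a q)) + X =
    (((a + a⁻¹) * (b + b⁻¹) + (c + c⁻¹) * (q ^ ((d : ℤ) + 1) + q ^ (-(d : ℤ) - 1))) /
        (q + q⁻¹)) • (1 : Matrix (Fin (d + 1)) (Fin (d + 1)) K))

/-- The restriction to indices `0, …, d` of a matrix indexed by `ℤ`. -/
def intRestrict {K : Type*} (d : ℕ) (F : ℤ → ℤ → K) : Matrix (Fin (d + 1)) (Fin (d + 1)) K :=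
  Matrix.of fun i j => F (i : ℕ) (j : ℕ)

/-- The tridiagonal matrix indexed by `ℤ` whose `i`-th row has entries `l i`, `m i`, `u i`. -/
def intTridiag {K : Type*} [Zero K] [Add K] (l m u : ℤ → K) (i j : ℤ) : K :=
  (if j = i - 1 then l i else 0) + (if j = i then m i else 0) + (if j = i + 1 then u i else 0)

lemma sum_fin_ite_intCast_eq {K : Type*} [AddCommMonoid K] (d : ℕ) (t : ℤ) (f : ℤ → K)
    (h : t < 0 ∨ (d : ℤ) < t → f t = 0) :
    ∑ k : Fin (d + 1), (if ((k : ℕ) : ℤ) = t then f (k : ℕ) else 0) = f t := by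
  by_cases ht : t < 0 ∨ (d : ℤ) < t
  · rw [h ht]
    refine Finset.sum_eq_zero fun k _ => if_neg ?_
    have := k.isLt
    omega
  · rw [Finset.sum_eq_single ⟨t.toNat, by omega⟩]
    · have : ((t.toNat : ℕ) : ℤ) = t := by omega
      simp [this]
    · intro k _ hk
      refine if_neg fun hkt => hk (Fin.ext ?_)
      change (k : ℕ) = t.toNat
      omega
    · simp

/-- Restriction is multiplicative on a tridiagonal left factor as soon as no contribution
comes from the indices `-1` and `d + 1`. -/
lemma intRestrict_tridiag_mul {K : Type*} [Semiring K] (d : ℕ) (l m u : ℤ → K) (G : ℤ → ℤ → K)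
    (h₀ : ∀ j : ℤ, 0 ≤ j → l 0 * G (-1) j = 0)
    (hd : ∀ j : ℤ, j ≤ d → u d * G (d + 1) j = 0) :
    intRestrict d (intTridiag l m u) * intRestrict d G =
      intRestrict d fun i j => l i * G (i - 1) j + m i * G i j + u i * G (i + 1) j := by
  ext ⟨i, hi⟩ ⟨j, hj⟩
  simp only [Matrix.mul_apply, intRestrict, intTridiag, Matrix.of_apply, add_mul, ite_mul,
    zero_mul, Finset.sum_add_distrib]
  rw [sum_fin_ite_intCast_eq d _ (fun k => l i * G k j),
    sum_fin_ite_intCast_eq d _ (fun k => m i * G k j),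
    sum_fin_ite_intCast_eq d _ (fun k => u i * G k j)]
  · intro h
    obtain rfl : i = d := by omega
    exact hd j (by omega)
  · omega
  · intro h
    obtain rfl : i = 0 := by omega
    simpa using h₀ j (by omega)

lemma one_eq_intRestrict {K : Type*} [Semiring K] (d : ℕ) :
    (1 : Matrix (Fin (d + 1)) (Fin (d + 1)) K) = intRestrict d (intTridiag 0 1 0) := by
  ext i j
  simp [intRestrict, intTridiag, Matrix.one_apply, Fin.ext_iff, eq_comm]

section AskeyWilson

variable {K : Type*} [Field K]

/-- The eigenvalue sequence `qθ` extended to integer indices. -/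
noncomputable def intTheta (d : ℕ) (a q : K) (i : ℤ) : K :=
  a * q ^ (2 * i - (d : ℤ)) + a⁻¹ * q ^ ((d : ℤ) - 2 * i)

/-- The split sequence `qφ` extended to integer indices. -/
noncomputable def intPhi (d : ℕ) (a b c q : K) (i : ℤ) : K :=
  a⁻¹ * b⁻¹ * q ^ ((d : ℤ) + 1) * (q ^ i - q ^ (-i)) *
    (q ^ (i - (d : ℤ) - 1) - q ^ ((d : ℤ) - i + 1)) *
    (q ^ (-i) - a * b * c * q ^ (i - (d : ℤ) - 1)) *
    (q ^ (-i) - a * b * c⁻¹ * q ^ (i - (d : ℤ) - 1))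

lemma intPhi_zero (d : ℕ) (a b c q : K) : intPhi d a b c q 0 = 0 := by
  simp [intPhi]

lemma intPhi_succ (d : ℕ) (a b c q : K) : intPhi d a b c q (d + 1) = 0 := by
  simp [intPhi]

lemma intTheta_eq (d : ℕ) (a : K) {q : K} (hq : q ≠ 0) (i : ℤ) :
    intTheta d a q i =
      a * q ^ (2 * i - (d : ℤ) - 1) * q + a⁻¹ * (q ^ (2 * i - (d : ℤ) - 1))⁻¹ * q⁻¹ := by
  rw [intTheta, mul_assoc a, mul_assoc a⁻¹, ← mul_inv, ← zpow_add_one₀ hq, ← zpow_neg]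
  congr 3 <;> ring

lemma intPhi_eq (d : ℕ) {a b c q : K} (ha : a ≠ 0) (hb : b ≠ 0) (hc : c ≠ 0) (hq : q ≠ 0)
    (i : ℤ) :
    intPhi d a b c q i =
      (q ^ (2 * i - (d : ℤ) - 1) + (q ^ (2 * i - (d : ℤ) - 1))⁻¹ -
        (q ^ ((d : ℤ) + 1) + q ^ (-(d : ℤ) - 1))) *
      (a * b * q ^ (2 * i - (d : ℤ) - 1) + (a * b * q ^ (2 * i - (d : ℤ) - 1))⁻¹ - (c + c⁻¹)) := by
  simp only [intPhi, two_mul, sub_eq_add_neg, neg_add, zpow_add₀ hq, zpow_neg, zpow_one]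
  have h₁ : q ^ i ≠ 0 := zpow_ne_zero _ hq
  have h₂ : q ^ (d : ℤ) ≠ 0 := zpow_ne_zero _ hq
  generalize q ^ i = x, q ^ (d : ℤ) = y at h₁ h₂ ⊢
  field_simp
  ring

lemma zpow_two_mul_succ {q : K} (hq : q ≠ 0) (d i : ℤ) :
    q ^ (2 * (i + 1) - d - 1) = q ^ (2 * i - d - 1) * q ^ 2 := by
  rw [← zpow_natCast q 2, ← zpow_add₀ hq]
  congr 1
  push_cast
  ring

lemma zpow_two_mul_pred {q : K} (hq : q ≠ 0) (d i : ℤ) :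
    q ^ (2 * (i - 1) - d - 1) = q ^ (2 * i - d - 1) * (q ^ 2)⁻¹ := by
  rw [eq_mul_inv_iff_mul_eq₀ (pow_ne_zero 2 hq), ← zpow_two_mul_succ hq, sub_add_cancel]

lemma matA_eq (d : ℕ) (a q : K) :
    matA d a q = intRestrict d (intTridiag (fun _ => 1) (intTheta d a q) 0) := by
  ext ⟨i, hi⟩ ⟨j, hj⟩
  simp only [matA, intRestrict, intTridiag, Matrix.of_apply, Pi.zero_apply, ite_self, add_zero,
    intTheta, qθ]
  grind

lemma matAs_eq (d : ℕ) (a b c q : K) :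
    matAs d a b c q =
      intRestrict d (intTridiag 0 (intTheta d b q) fun i => intPhi d a b c q (i + 1)) := by
  ext ⟨i, hi⟩ ⟨j, hj⟩
  simp only [matAs, intRestrict, intTridiag, Matrix.of_apply, Pi.zero_apply, ite_self, zero_add,
    intTheta, intPhi, qθ, qφ]
  grind

/-- The numerator `q⁻¹ A* A - q A A* + (q - q⁻¹) γ`, with `γ` the scalar in the third relation. -/
noncomputable def epsNum (d : ℕ) (a b c q : K) : ℤ → ℤ → K :=
  intTridiag
    (fun i => q⁻¹ * intTheta d b q i - q * intTheta d b q (i - 1))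
    (fun i => (q⁻¹ - q) * (intTheta d a q i * intTheta d b q i) +
      q⁻¹ * intPhi d a b c q (i + 1) - q * intPhi d a b c q i +
      (q - q⁻¹) * ((a + a⁻¹) * (b + b⁻¹) +
        (c + c⁻¹) * (q ^ ((d : ℤ) + 1) + q ^ (-(d : ℤ) - 1))))
    (fun i => intPhi d a b c q (i + 1) *
      (q⁻¹ * intTheta d a q (i + 1) - q * intTheta d a q i))

lemma epsNum_eq (d : ℕ) (a b c q : K) :
    q⁻¹ • (matAs d a b c q * matA d a q) - q • (matA d a q * matAs d a b c q) +
      ((q - q⁻¹) * ((a + a⁻¹) * (b + b⁻¹) +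
        (c + c⁻¹) * (q ^ ((d : ℤ) + 1) + q ^ (-(d : ℤ) - 1)))) • 1 =
      intRestrict d (epsNum d a b c q) := by
  rw [matA_eq, matAs_eq, intRestrict_tridiag_mul, intRestrict_tridiag_mul]
  · rw [one_eq_intRestrict]
    ext i j
    simp only [intRestrict, Matrix.add_apply, Matrix.sub_apply, Matrix.smul_apply,
      Matrix.of_apply, smul_eq_mul]
    generalize ((i : ℕ) : ℤ) = i, ((j : ℕ) : ℤ) = j
    simp only [epsNum, intTridiag, Pi.zero_apply, Pi.one_apply, ite_self]
    by_cases h : j = i - 1 ∨ j = i ∨ j = i + 1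
    · obtain rfl | rfl | rfl := h <;>
      · simp (disch := omega) only [↓reduceIte, if_pos, if_neg, sub_add_cancel]
        ring
    · simp (disch := omega) only [if_neg]
      ring
  · intro j hj
    simp only [intTridiag, Pi.zero_apply, ite_self]
    rcases eq_or_lt_of_le hj with rfl | hj
    · simp [intPhi_zero]
    · simp (disch := omega) [if_neg]
  · simp
  · simp
  · intro j hj
    simp [intPhi_succ]

lemma epsNum_relation_matA (d : ℕ) (a b c q : K)
    (ha : a ≠ 0) (hb : b ≠ 0) (hc : c ≠ 0) (hq : q ≠ 0) :
    q • (intRestrict d (epsNum d a b c q) * matA d a q) -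
      q⁻¹ • (matA d a q * intRestrict d (epsNum d a b c q)) +
      (q ^ 2 - q ^ (-2 : ℤ)) ^ 2 • matAs d a b c q =
    ((q ^ 2 - q ^ (-2 : ℤ)) * (q - q⁻¹) * ((c + c⁻¹) * (a + a⁻¹) +
      (b + b⁻¹) * (q ^ ((d : ℤ) + 1) + q ^ (-(d : ℤ) - 1)))) • 1 := by
  rw [matA_eq, matAs_eq, epsNum, intRestrict_tridiag_mul, intRestrict_tridiag_mul]
  · rw [one_eq_intRestrict]
    ext i j
    simp only [intRestrict, Matrix.add_apply, Matrix.sub_apply, Matrix.smul_apply,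
      Matrix.of_apply, smul_eq_mul]
    generalize ((i : ℕ) : ℤ) = i, ((j : ℕ) : ℤ) = j
    simp only [intTridiag, Pi.zero_apply, Pi.one_apply, ite_self]
    have ht : q ^ (2 * i - (d : ℤ) - 1) ≠ 0 := zpow_ne_zero _ hq
    by_cases h : j = i - 2 ∨ j = i - 1 ∨ i = j ∨ j = i + 1
    · obtain rfl | rfl | rfl | rfl := h <;>
      · simp (disch := omega) only [↓reduceIte, if_pos, if_neg]
        simp only [intTheta_eq _ _ hq, intPhi_eq _ ha hb hc hq, zpow_two_mul_succ hq,
          zpow_two_mul_pred hq, zpow_neg, zpow_ofNat, sub_add_cancel, add_sub_cancel_right]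
        generalize q ^ (2 * i - (d : ℤ) - 1) = t at ht ⊢
        generalize q ^ ((d : ℤ) + 1) + q ^ (-(d : ℤ) - 1) = N
        field_simp
        ring
    · simp (disch := omega) only [if_neg]
      ring
  · intro j hj
    simp only [intTridiag]
    rcases eq_or_lt_of_le hj with rfl | hj
    · simp [intPhi_zero]
    · simp (disch := omega) [if_neg]
  · simp
  · intro j hj
    simp (disch := omega) [intTridiag, if_neg]
  · intro j hj
    simp [intPhi_succ]

lemma epsNum_relation_matAs (d : ℕ) (a b c q : K)
    (ha : a ≠ 0) (hb : b ≠ 0) (hc : c ≠ 0) (hq : q ≠ 0) :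
    q • (matAs d a b c q * intRestrict d (epsNum d a b c q)) -
      q⁻¹ • (intRestrict d (epsNum d a b c q) * matAs d a b c q) +
      (q ^ 2 - q ^ (-2 : ℤ)) ^ 2 • matA d a q =
    ((q ^ 2 - q ^ (-2 : ℤ)) * (q - q⁻¹) * ((b + b⁻¹) * (c + c⁻¹) +
      (a + a⁻¹) * (q ^ ((d : ℤ) + 1) + q ^ (-(d : ℤ) - 1)))) • 1 := by
  rw [matA_eq, matAs_eq, epsNum, intRestrict_tridiag_mul, intRestrict_tridiag_mul]
  · rw [one_eq_intRestrict]
    ext i j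
    simp only [intRestrict, Matrix.add_apply, Matrix.sub_apply, Matrix.smul_apply,
      Matrix.of_apply, smul_eq_mul]
    generalize ((i : ℕ) : ℤ) = i, ((j : ℕ) : ℤ) = j
    simp only [intTridiag, Pi.zero_apply, Pi.one_apply, ite_self]
    have ht : q ^ (2 * i - (d : ℤ) - 1) ≠ 0 := zpow_ne_zero _ hq
    by_cases h : j = i + 2 ∨ j = i - 1 ∨ i = j ∨ j = i + 1
    · obtain rfl | rfl | rfl | rfl := h <;>
      · simp (disch := omega) only [↓reduceIte, if_pos, if_neg]
        simp only [intTheta_eq _ _ hq, intPhi_eq _ ha hb hc hq, zpow_two_mul_succ hq,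
          zpow_two_mul_pred hq, zpow_neg, zpow_ofNat, sub_add_cancel, add_sub_cancel_right]
        generalize q ^ (2 * i - (d : ℤ) - 1) = t at ht ⊢
        generalize q ^ ((d : ℤ) + 1) + q ^ (-(d : ℤ) - 1) = N
        field_simp
        ring
    · simp (disch := omega) only [if_neg]
      ring
  · intro j hj
    simp only [intTridiag]
    rcases eq_or_lt_of_le hj with rfl | hj
    · simp [intPhi_zero]
    · simp (disch := omega) [if_neg]
  · intro j hj
    simp [intPhi_succ]
  · simp
  · intro j hj
    simp [intPhi_succ]

end AskeyWilson

/-- Theorem 10.1: A^ε is the unique matrix satisfying the ℤ₃-symmetric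
Askey–Wilson relations. -/
theorem stmt_9 {K : Type*} [Field K] [IsAlgClosed K] (d : ℕ) (hd : 3 ≤ d)
    (a b c q : K) (h : QRACred d a b c q) :
    Z3AW d a b c q (matAe d a b c q) ∧
    ∀ X : Matrix (Fin (d + 1)) (Fin (d + 1)) K, Z3AW d a b c q X → X = matAe d a b c q := by
  obtain ⟨⟨ha, hb, hc, hq⟩, hq2, -, -⟩ := h
  have hw : q ^ 2 - q ^ (-2 : ℤ) ≠ 0 := fun h => by
    refine hq2 2 (by norm_num) (by omega) ?_
    rw [zpow_neg] at h
    field_simp at h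
    grind
  have hs : q + q⁻¹ ≠ 0 := fun h => by
    refine hq2 2 (by norm_num) (by omega) ?_
    field_simp at h
    grind
  have hdiv (x : K) : x / (q + q⁻¹) = (q ^ 2 - q ^ (-2 : ℤ))⁻¹ * ((q - q⁻¹) * x) := by
    have : q ^ 2 - q ^ (-2 : ℤ) = (q - q⁻¹) * (q + q⁻¹) := by
      rw [zpow_neg]
      field_simp
      ring
    have h' : q - q⁻¹ ≠ 0 := left_ne_zero_of_mul (this ▸ hw)
    rw [this]
    generalize q - q⁻¹ = u at h' ⊢
    generalize q + q⁻¹ = v at hs ⊢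
    field_simp
  have hX : matAe d a b c q =
      (q ^ 2 - q ^ (-2 : ℤ))⁻¹ • intRestrict d (epsNum d a b c q) := by
    rw [← epsNum_eq, matAe, hdiv, smul_add, smul_smul]
  have hrel {P Q R : Matrix (Fin (d + 1)) (Fin (d + 1)) K} {w t : K} (hw : w ≠ 0)
      (hPQ : q • P - q⁻¹ • Q + w ^ 2 • R = (w * (q - q⁻¹) * t) • 1) :
      w⁻¹ • (q • w⁻¹ • P - q⁻¹ • w⁻¹ • Q) + R = (w⁻¹ * ((q - q⁻¹) * t)) • 1 := by
    have := congrArg ((w⁻¹ ^ 2) • ·) hPQ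
    simp only [smul_add, smul_sub, smul_smul] at this ⊢
    rw [← mul_pow, inv_mul_cancel₀ hw, one_pow, one_smul] at this
    convert this using 2
    · congr 2 <;> ring
    · field_simp
  refine ⟨⟨?_, ?_, ?_⟩, fun X hX' => ?_⟩
  · rw [hX, hdiv, mul_smul_comm, smul_mul_assoc]
    exact hrel hw (epsNum_relation_matAs d a b c q ha hb hc hq)
  · rw [hX, hdiv, mul_smul_comm, smul_mul_assoc]
    exact hrel hw (epsNum_relation_matA d a b c q ha hb hc hq)
  · rw [matAe, ← sub_eq_zero]
    module
  · rw [matAe, ← hX'.2.2, ← sub_eq_zero]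
    module
end

section
/- The matrices A and A* satisfy the Askey–Wilson relations A²A* − (q²+q^{−2})·AA*A + A*A² + (q²−q^{−2})²·A* = ω·A + η·I and (A*)²A − (q²+q^{−2})·A*AA* + A(A*)² + (q²−q^{−2})²·A = ω·A* + η*·I, where ω = −(q−q^{−1})²·((a+a^{−1})(b+b^{−1}) + (c+c^{−1})(q^{d+1}+q^{−d−1})), η = (q−q^{−1})(q²−q^{−2})·((c+c^{−1})(a+a^{−1}) + (b+b^{−1})(q^{d+1}+q^{−d−1})), and η* = (q−q^{−1})(q²−q^{−2})·((b+b^{−1})(c+c^{−1}) + (a+a^{−1})(q^{d+1}+q^{−d−1})). -/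
/-- A lower bidiagonal matrix with subdiagonal `1`, as an operator on two-sided sequences. -/
def lowerShift {K : Type*} [Field K] (θ f : ℤ → K) (i : ℤ) : K :=
  θ i * f i + f (i - 1)

/-- An upper bidiagonal matrix, as an operator on two-sided sequences. -/
def upperShift {K : Type*} [Field K] (θs φ f : ℤ → K) (i : ℤ) : K :=
  θs i * f i + φ (i + 1) * f (i + 1)

section Truncation

variable {K : Type*} [Field K] {d : ℕ}

theorem lowerShift_of_neg {θ f : ℤ → K} (hf : ∀ i < 0, f i = 0) :
    ∀ i < 0, lowerShift θ f i = 0 := by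
  intro i hi
  simp [lowerShift, hf i hi, hf (i - 1) (by lia)]

theorem upperShift_of_neg {θs φ f : ℤ → K} (hφ : φ 0 = 0) (hf : ∀ i < 0, f i = 0) :
    ∀ i < 0, upperShift θs φ f i = 0 := by
  intro i hi
  have h : φ (i + 1) * f (i + 1) = 0 := by
    rcases eq_or_ne (i + 1) 0 with h | h
    · simp [h, hφ]
    · simp [hf (i + 1) (by lia)]
  simp [upperShift, hf i hi, h]

theorem mulVec_eq_lowerShift (M : Matrix (Fin (d + 1)) (Fin (d + 1)) K) (θ f : ℤ → K)
    (hM : ∀ i j : Fin (d + 1), M i j =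
      if (i : ℕ) = (j : ℕ) then θ (i : ℕ) else if (i : ℕ) = (j : ℕ) + 1 then 1 else 0)
    (hf : ∀ i < 0, f i = 0) :
    M.mulVec (fun j : Fin (d + 1) => f (j : ℕ)) = fun i : Fin (d + 1) => lowerShift θ f (i : ℕ) := by
  funext i
  have hsplit : ∀ j : Fin (d + 1), M i j * f (j : ℕ) =
      (if j = i then θ (i : ℕ) * f (i : ℕ) else 0) +
        (if (i : ℕ) = (j : ℕ) + 1 then f ((i : ℕ) - 1) else 0) := by
    intro j
    rw [hM]
    rcases eq_or_ne j i with rfl | hji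
    · simp
    · have : (i : ℕ) ≠ j := fun h => hji (Fin.ext h.symm)
      by_cases h : (i : ℕ) = j + 1 <;> simp [hji, this, h]
  simp only [Matrix.mulVec, dotProduct, hsplit, Finset.sum_add_distrib, Finset.sum_ite_eq',
    Finset.mem_univ, if_true, lowerShift]
  congr 1
  obtain ⟨i, hi⟩ := i
  rcases i with _ | k
  · simp [hf (-1) (by lia)]
  · rw [Finset.sum_eq_single ⟨k, by lia⟩] <;> simp [Fin.ext_iff]
    lia

theorem mulVec_eq_upperShift (M : Matrix (Fin (d + 1)) (Fin (d + 1)) K) (θs φ f : ℤ → K)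
    (hM : ∀ i j : Fin (d + 1), M i j =
      if (i : ℕ) = (j : ℕ) then θs (i : ℕ) else if (j : ℕ) = (i : ℕ) + 1 then φ (j : ℕ) else 0)
    (hφ : φ (d + 1) = 0) :
    M.mulVec (fun j : Fin (d + 1) => f (j : ℕ)) = fun i : Fin (d + 1) => upperShift θs φ f (i : ℕ) := by
  funext i
  have hsplit : ∀ j : Fin (d + 1), M i j * f (j : ℕ) =
      (if j = i then θs (i : ℕ) * f (i : ℕ) else 0) +
        (if (j : ℕ) = (i : ℕ) + 1 then φ ((i : ℕ) + 1) * f ((i : ℕ) + 1) else 0) := by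
    intro j
    rw [hM]
    rcases eq_or_ne j i with rfl | hji
    · simp
    · have : (i : ℕ) ≠ j := fun h => hji (Fin.ext h.symm)
      by_cases h : (j : ℕ) = i + 1 <;> simp [hji, this, h]
  simp only [Matrix.mulVec, dotProduct, hsplit, Finset.sum_add_distrib, Finset.sum_ite_eq',
    Finset.mem_univ, if_true, upperShift]
  congr 1
  obtain ⟨i, hi⟩ := i
  rcases eq_or_ne i d with rfl | hid
  · simp [hφ]
  · rw [Finset.sum_eq_single ⟨i + 1, by lia⟩] <;> simp [Fin.ext_iff]
    lia

theorem exists_extension (v : Fin (d + 1) → K) :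
    ∃ f : ℤ → K, (∀ i < 0, f i = 0) ∧ v = fun j : Fin (d + 1) => f (j : ℕ) := by
  refine ⟨fun i => if h : 0 ≤ i ∧ i < d + 1 then v ⟨i.toNat, by lia⟩ else 0, ?_, ?_⟩
  · intro i hi
    exact dif_neg (by lia)
  · funext j
    have h : (0 : ℤ) ≤ (j : ℕ) ∧ ((j : ℕ) : ℤ) < d + 1 := by
      have := j.isLt
      lia
    simp [h]

/-- Entrywise criterion for a lower and an upper bidiagonal matrix to satisfy the
Askey–Wilson relations. -/
theorem askeyWilson_of_entries (A B : Matrix (Fin (d + 1)) (Fin (d + 1)) K)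
    (θ θs φ : ℤ → K) (β γ ω η ηs : K)
    (hA : ∀ i j : Fin (d + 1), A i j =
      if (i : ℕ) = (j : ℕ) then θ (i : ℕ) else if (i : ℕ) = (j : ℕ) + 1 then 1 else 0)
    (hB : ∀ i j : Fin (d + 1), B i j =
      if (i : ℕ) = (j : ℕ) then θs (i : ℕ) else if (j : ℕ) = (i : ℕ) + 1 then φ (j : ℕ) else 0)
    (hφ₀ : φ 0 = 0) (hφd : φ (d + 1) = 0)
    (recθ : ∀ i, θ (i - 1) - β * θ i + θ (i + 1) = 0)
    (recθs : ∀ i, θs (i - 1) - β * θs i + θs (i + 1) = 0)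
    (quad : ∀ i, θ i ^ 2 - β * (θ i * θ (i + 1)) + θ (i + 1) ^ 2 + γ = 0)
    (quads : ∀ i, θs i ^ 2 - β * (θs i * θs (i + 1)) + θs (i + 1) ^ 2 + γ = 0)
    (off : ∀ i, (θ i + θ (i + 1)) * (θs i + θs (i + 1)) + φ i + φ (i + 2)
      - β * (θ i * θs i + θ (i + 1) * θs (i + 1) + φ (i + 1)) = ω)
    (diag : ∀ i, 2 * θ i ^ 2 * θs i + (θ i + θ (i - 1)) * φ i + (θ i + θ (i + 1)) * φ (i + 1)
      - β * (θ i ^ 2 * θs i + θ i * (φ i + φ (i + 1))) + γ * θs i = ω * θ i + η)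
    (diags : ∀ i, 2 * θs i ^ 2 * θ i + (θs i + θs (i - 1)) * φ i
      + (θs i + θs (i + 1)) * φ (i + 1)
      - β * (θs i ^ 2 * θ i + θs i * (φ i + φ (i + 1))) + γ * θ i = ω * θs i + ηs) :
    (A ^ 2 * B - β • (A * B * A) + B * A ^ 2 + γ • B = ω • A + η • 1) ∧
      (B ^ 2 * A - β • (B * A * B) + A * B ^ 2 + γ • A = ω • B + ηs • 1) := by
  have mulA (f : ℤ → K) (hf : ∀ i < 0, f i = 0) := mulVec_eq_lowerShift A θ f hA hf
  have mulB (f : ℤ → K) := mulVec_eq_upperShift B θs φ f hB hφd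
  constructor <;> apply Matrix.toLin'.injective <;> apply LinearMap.ext <;> intro v <;>
    obtain ⟨f, hf, rfl⟩ := exists_extension v
  · have hAf := lowerShift_of_neg (θ := θ) hf
    have hBf := upperShift_of_neg (θs := θs) hφ₀ hf
    have hBAf := upperShift_of_neg (θs := θs) hφ₀ hAf
    have hABf := lowerShift_of_neg (θ := θ) hBf
    simp only [Matrix.toLin'_apply, pow_two, Matrix.add_mulVec, Matrix.sub_mulVec,
      Matrix.smul_mulVec, ← Matrix.mulVec_mulVec, Matrix.one_mulVec, mulB, mulA f hf,
      mulA _ hAf, mulA _ hBf, mulA _ hBAf, mulA _ hABf]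
    funext i
    generalize hk : ((i : ℕ) : ℤ) = k
    simp only [Pi.add_apply, Pi.sub_apply, Pi.smul_apply, smul_eq_mul, hk, lowerShift, upperShift]
    have e := off (k - 1)
    have r := recθs (k - 1)
    have p := diag k
    have u := quad k
    simp only [sub_add_cancel, add_sub_cancel_right,
      show k - 1 + 2 = k + 1 by ring] at *
    linear_combination f (k - 1 - 1) * r + f (k - 1) * e + f k * p + φ (k + 1) * f (k + 1) * u
  · have hAf := lowerShift_of_neg (θ := θ) hf
    have hBf := upperShift_of_neg (θs := θs) hφ₀ hf
    have hBBf := upperShift_of_neg (θs := θs) hφ₀ hBf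
    simp only [Matrix.toLin'_apply, pow_two, Matrix.add_mulVec, Matrix.sub_mulVec,
      Matrix.smul_mulVec, ← Matrix.mulVec_mulVec, Matrix.one_mulVec, mulB, mulA f hf,
      mulA _ hBf, mulA _ hBBf]
    funext i
    generalize hk : ((i : ℕ) : ℤ) = k
    simp only [Pi.add_apply, Pi.sub_apply, Pi.smul_apply, smul_eq_mul, hk, lowerShift, upperShift]
    have e := off k
    have r := recθ (k + 1)
    have p := diags k
    have u := quads (k - 1)
    simp only [sub_add_cancel, add_sub_cancel_right, show k + 1 + 1 = k + 2 by ring,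
      show k + 2 - 1 = k + 1 by ring] at *
    linear_combination φ (k + 1) * φ (k + 2) * f (k + 2) * r + φ (k + 1) * f (k + 1) * e
      + f k * p + f (k - 1) * u

end Truncation

/-- The sequence `qθ` as a function of `x = q ^ i`, with `D = q ^ d`. -/
def laurentθ {K : Type*} [Field K] (D a x : K) : K :=
  a * (x ^ 2 / D) + a⁻¹ * (D / x ^ 2)

/-- The sequence `qφ` as a function of `x = q ^ i`, with `D = q ^ d`. -/
def laurentφ {K : Type*} [Field K] (D a b c q x : K) : K :=
  a⁻¹ * b⁻¹ * (D * q) * (x - x⁻¹) * (x / (D * q) - D * q / x) *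
    (x⁻¹ - a * b * c * (x / (D * q))) * (x⁻¹ - a * b * c⁻¹ * (x / (D * q)))

section Laurent

variable {K : Type*} [Field K] {D a b c q x : K}

theorem laurentφ_one : laurentφ D a b c q 1 = 0 := by
  simp [laurentφ]

theorem laurentφ_mul_self (hD : D ≠ 0) (hq : q ≠ 0) : laurentφ D a b c q (D * q) = 0 := by
  simp [laurentφ, hD, hq]

theorem laurentφ_comm : laurentφ D a b c q x = laurentφ D b a c q x := by
  simp only [laurentφ]
  ring

theorem laurentθ_recurrence (hD : D ≠ 0) (ha : a ≠ 0) (hq : q ≠ 0) (hx : x ≠ 0) :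
    laurentθ D a (x / q) - (q ^ 2 + (q ^ 2)⁻¹) * laurentθ D a x + laurentθ D a (x * q) = 0 := by
  simp only [laurentθ]
  field_simp
  ring

theorem laurentθ_quadratic (hD : D ≠ 0) (ha : a ≠ 0) (hq : q ≠ 0) (hx : x ≠ 0) :
    laurentθ D a x ^ 2 - (q ^ 2 + (q ^ 2)⁻¹) * (laurentθ D a x * laurentθ D a (x * q))
      + laurentθ D a (x * q) ^ 2 + (q ^ 2 - (q ^ 2)⁻¹) ^ 2 = 0 := by
  simp only [laurentθ]
  field_simp
  ring

theorem laurent_offDiag (hD : D ≠ 0) (ha : a ≠ 0) (hb : b ≠ 0) (hc : c ≠ 0) (hq : q ≠ 0)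
    (hx : x ≠ 0) :
    (laurentθ D a x + laurentθ D a (x * q)) * (laurentθ D b x + laurentθ D b (x * q))
      + laurentφ D a b c q x + laurentφ D a b c q (x * q ^ 2)
      - (q ^ 2 + (q ^ 2)⁻¹) * (laurentθ D a x * laurentθ D b x
        + laurentθ D a (x * q) * laurentθ D b (x * q) + laurentφ D a b c q (x * q)) =
    -(q - q⁻¹) ^ 2 * ((a + a⁻¹) * (b + b⁻¹) + (c + c⁻¹) * (D * q + (D * q)⁻¹)) := by
  simp only [laurentθ, laurentφ]
  field_simp
  ring

theorem laurent_diag (hD : D ≠ 0) (ha : a ≠ 0) (hb : b ≠ 0) (hc : c ≠ 0) (hq : q ≠ 0)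
    (hx : x ≠ 0) :
    2 * laurentθ D a x ^ 2 * laurentθ D b x
      + (laurentθ D a x + laurentθ D a (x / q)) * laurentφ D a b c q x
      + (laurentθ D a x + laurentθ D a (x * q)) * laurentφ D a b c q (x * q)
      - (q ^ 2 + (q ^ 2)⁻¹) * (laurentθ D a x ^ 2 * laurentθ D b x
        + laurentθ D a x * (laurentφ D a b c q x + laurentφ D a b c q (x * q)))
      + (q ^ 2 - (q ^ 2)⁻¹) ^ 2 * laurentθ D b x =
    -(q - q⁻¹) ^ 2 * ((a + a⁻¹) * (b + b⁻¹) + (c + c⁻¹) * (D * q + (D * q)⁻¹)) * laurentθ D a x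
      + (q - q⁻¹) * (q ^ 2 - (q ^ 2)⁻¹) *
        ((c + c⁻¹) * (a + a⁻¹) + (b + b⁻¹) * (D * q + (D * q)⁻¹)) := by
  simp only [laurentθ, laurentφ]
  field_simp
  ring

theorem qθ_eq_laurentθ (d : ℕ) (hq : q ≠ 0) (i : ℕ) :
    qθ d a q i = laurentθ (q ^ d) a (q ^ (i : ℤ)) := by
  simp only [qθ, laurentθ, zpow_sub₀ hq, two_mul, zpow_add₀ hq, zpow_natCast, pow_two]

theorem qφ_eq_laurentφ (d : ℕ) (hq : q ≠ 0) (i : ℕ) :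
    qφ d a b c q i = laurentφ (q ^ d) a b c q (q ^ (i : ℤ)) := by
  have h : q ^ d / q ^ i * q = q ^ d * q / q ^ i := by ring
  simp only [qφ, laurentφ, zpow_sub₀ hq, zpow_add₀ hq, zpow_neg, zpow_one, div_div,
    zpow_natCast, h]

end Laurent

/-- Lemma 9.2: A, A* satisfy the Askey–Wilson relations with the stated parameters. -/
theorem stmt_10 {K : Type*} [Field K] [IsAlgClosed K] (d : ℕ) (hd : 3 ≤ d)
    (a b c q : K) (h : QRACred d a b c q) :
    (matA d a q ^ 2 * matAs d a b c q -
        (q ^ 2 + q ^ (-2 : ℤ)) • (matA d a q * matAs d a b c q * matA d a q) +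
        matAs d a b c q * matA d a q ^ 2 +
        ((q ^ 2 - q ^ (-2 : ℤ)) ^ 2) • matAs d a b c q =
      (-(q - q⁻¹) ^ 2 *
          ((a + a⁻¹) * (b + b⁻¹) + (c + c⁻¹) * (q ^ ((d : ℤ) + 1) + q ^ (-(d : ℤ) - 1)))) •
          matA d a q +
        ((q - q⁻¹) * (q ^ 2 - q ^ (-2 : ℤ)) *
          ((c + c⁻¹) * (a + a⁻¹) + (b + b⁻¹) * (q ^ ((d : ℤ) + 1) + q ^ (-(d : ℤ) - 1)))) •
          (1 : Matrix (Fin (d + 1)) (Fin (d + 1)) K)) ∧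
    (matAs d a b c q ^ 2 * matA d a q -
        (q ^ 2 + q ^ (-2 : ℤ)) • (matAs d a b c q * matA d a q * matAs d a b c q) +
        matA d a q * matAs d a b c q ^ 2 +
        ((q ^ 2 - q ^ (-2 : ℤ)) ^ 2) • matA d a q =
      (-(q - q⁻¹) ^ 2 *
          ((a + a⁻¹) * (b + b⁻¹) + (c + c⁻¹) * (q ^ ((d : ℤ) + 1) + q ^ (-(d : ℤ) - 1)))) •
          matAs d a b c q +
        ((q - q⁻¹) * (q ^ 2 - q ^ (-2 : ℤ)) *
          ((b + b⁻¹) * (c + c⁻¹) + (a + a⁻¹) * (q ^ ((d : ℤ) + 1) + q ^ (-(d : ℤ) - 1)))) •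
          (1 : Matrix (Fin (d + 1)) (Fin (d + 1)) K)) := by
  obtain ⟨⟨ha, hb, hc, hq⟩, -⟩ := h
  have hD : q ^ d ≠ 0 := pow_ne_zero d hq
  have hx (i : ℤ) : q ^ i ≠ 0 := zpow_ne_zero i hq
  have hinv : q ^ (-2 : ℤ) = (q ^ 2)⁻¹ := by
    rw [zpow_neg]
    norm_cast
  have hdq : q ^ ((d : ℤ) + 1) + q ^ (-(d : ℤ) - 1) = q ^ d * q + (q ^ d * q)⁻¹ := by
    rw [← neg_add', zpow_neg, zpow_add_one₀ hq, zpow_natCast]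
  have hadd (i : ℤ) : q ^ (i + 1) = q ^ i * q := zpow_add_one₀ hq i
  have hadd₂ (i : ℤ) : q ^ (i + 2) = q ^ i * q ^ 2 := by
    rw [zpow_add₀ hq]
    norm_cast
  have hsub (i : ℤ) : q ^ (i - 1) = q ^ i / q := by rw [zpow_sub₀ hq, zpow_one]
  rw [hinv, hdq]
  apply askeyWilson_of_entries _ _ (fun i => laurentθ (q ^ d) a (q ^ i))
    (fun i => laurentθ (q ^ d) b (q ^ i)) (fun i => laurentφ (q ^ d) a b c q (q ^ i))
  · intro i j
    simp only [matA, Matrix.of_apply, qθ_eq_laurentθ d hq]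
  · intro i j
    simp only [matAs, Matrix.of_apply, qθ_eq_laurentθ d hq, qφ_eq_laurentφ d hq]
  · simpa using laurentφ_one
  · simpa only [hadd, zpow_natCast] using laurentφ_mul_self hD hq
  all_goals
    intro i
    simp only [hadd, hadd₂, hsub]
  · exact laurentθ_recurrence hD ha hq (hx i)
  · exact laurentθ_recurrence hD hb hq (hx i)
  · exact laurentθ_quadratic hD ha hq (hx i)
  · exact laurentθ_quadratic hD hb hq (hx i)
  · exact laurent_offDiag hD ha hb hc hq (hx i)
  · exact laurent_diag hD ha hb hc hq (hx i)
  · simp only [laurentφ_comm (a := a) (b := b)]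
    rw [laurent_diag hD hb ha hc hq (hx i)]
    ring
end

section
/- One has A^ε·M = M·B, equivalently M^{−1}·A^ε·M = B, where B ∈ Mat_{d+1}(𝕂) is the lower bidiagonal matrix with B_{ii} = θ^ε_i := c·q^{2i−d} + c^{−1}·q^{d−2i} for 0 ≤ i ≤ d, B_{i,i−1} = 1 for 1 ≤ i ≤ d, and all other entries 0. -/
/-- The q-Pochhammer symbol (x;t)_n = (1−x)(1−xt)⋯(1−x·t^{n−1}). -/
noncomputable def qpoch {K : Type*} [Field K] (x t : K) (n : ℕ) : K :=
  ∏ k ∈ Finset.range n, (1 - x * t ^ k)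

/-- The upper triangular matrix M of Definition 12.1. -/
noncomputable def matM {K : Type*} [Field K] (d : ℕ) (a b c q : K) :
    Matrix (Fin (d + 1)) (Fin (d + 1)) K :=
  Matrix.of fun i j =>
    if (i : ℕ) ≤ (j : ℕ) then
      (-1 : K) ^ (i : ℕ) * b ^ (-(i : ℤ)) * c ^ ((j : ℤ) - (i : ℤ)) *
        q ^ ((i : ℤ) ^ 2 + ((d : ℤ) - 2 * (i : ℤ)) * (j : ℤ)) *
        (qpoch (q ^ (2 * (i : ℤ) + 2)) (q ^ 2) ((j : ℕ) - (i : ℕ)) *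
          qpoch (q ^ (2 * (i : ℤ) - 2 * (d : ℤ))) (q ^ 2) ((j : ℕ) - (i : ℕ)) *
          qpoch (a⁻¹ * b⁻¹ * c⁻¹ * q ^ ((d : ℤ) - 2 * (j : ℤ) + 1)) (q ^ 2)
            ((j : ℕ) - (i : ℕ)) /
          qpoch (q ^ 2) (q ^ 2) ((j : ℕ) - (i : ℕ)))
    else 0

section QRacah

variable {K : Type*} [Field K]

lemma qpoch_succ (x t : K) (n : ℕ) : qpoch x t (n + 1) = qpoch x t n * (1 - x * t ^ n) :=
  Finset.prod_range_succ _ _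

lemma qpoch_succ_left (x t : K) (n : ℕ) :
    qpoch x t (n + 1) = (1 - x) * qpoch (x * t) t n := by
  simp only [qpoch]
  rw [Finset.prod_range_succ', mul_comm]
  simp [pow_succ', mul_assoc]

/-- The eigenvalue sequence `qθ`, extended to integer indices. -/
noncomputable def zθ (d : ℕ) (a q : K) (i : ℤ) : K :=
  a * q ^ (2 * i - (d : ℤ)) + a⁻¹ * q ^ ((d : ℤ) - 2 * i)

/-- The split sequence `qφ`, extended to integer indices. -/
noncomputable def zφ (d : ℕ) (a b c q : K) (i : ℤ) : K :=
  a⁻¹ * b⁻¹ * q ^ ((d : ℤ) + 1) * (q ^ i - q ^ (-i)) *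
    (q ^ (i - (d : ℤ) - 1) - q ^ ((d : ℤ) - i + 1)) *
    (q ^ (-i) - a * b * c * q ^ (i - (d : ℤ) - 1)) *
    (q ^ (-i) - a * b * c⁻¹ * q ^ (i - (d : ℤ) - 1))

lemma zφ_zero (d : ℕ) (a b c q : K) : zφ d a b c q 0 = 0 := by simp [zφ]

lemma zφ_top (d : ℕ) (a b c q : K) : zφ d a b c q ((d : ℤ) + 1) = 0 := by simp [zφ]

/-- The entry of `matM` in row `i` and column `i + n`, extended to integer `i`. -/
noncomputable def zM (d : ℕ) (a b c q : K) (i : ℤ) (n : ℕ) : K :=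
  (-1 : K) ^ i * b ^ (-i) * c ^ n * q ^ (i ^ 2 + ((d : ℤ) - 2 * i) * (i + n)) *
    (qpoch (q ^ (2 * i + 2)) (q ^ 2) n * qpoch (q ^ (2 * i - 2 * (d : ℤ))) (q ^ 2) n *
      qpoch (a⁻¹ * b⁻¹ * c⁻¹ * q ^ ((d : ℤ) - 2 * (i + n) + 1)) (q ^ 2) n /
      qpoch (q ^ 2) (q ^ 2) n)

/-- Column `j` of `matM` as a function of an integer row index. -/
noncomputable def zCol (d : ℕ) (a b c q : K) (j i : ℤ) : K :=
  if i ≤ j then zM d a b c q i (j - i).toNat else 0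

lemma matM_eq_zCol (d : ℕ) (a b c q : K) (i j : Fin (d + 1)) :
    matM d a b c q i j = zCol d a b c q (j : ℕ) (i : ℕ) := by
  by_cases hij : (i : ℕ) ≤ (j : ℕ)
  · have h1 : (((j : ℕ) : ℤ) - ((i : ℕ) : ℤ)).toNat = (j : ℕ) - (i : ℕ) := by omega
    have h2 : ((i : ℕ) : ℤ) + (((j : ℕ) - (i : ℕ) : ℕ) : ℤ) = (j : ℕ) := by omega
    have h3 : ((j : ℕ) : ℤ) - ((i : ℕ) : ℤ) = (((j : ℕ) - (i : ℕ) : ℕ) : ℤ) := by omega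
    simp only [matM, zCol, Matrix.of_apply, if_pos hij, Nat.cast_le, zM, h1, h2, zpow_natCast]
    rw [h3, zpow_natCast]
  · simp only [matM, zCol, Matrix.of_apply, if_neg hij, Nat.cast_le]

lemma matA_apply_sum (d : ℕ) (a q : K) (f : ℤ → K) (hf : f (-1) = 0) (i : Fin (d + 1)) :
    ∑ k : Fin (d + 1), matA d a q i k * f (k : ℕ) =
      zθ d a q (i : ℕ) * f (i : ℕ) + f ((i : ℕ) - 1) := by
  have key : ∀ k : Fin (d + 1), matA d a q i k * f (k : ℕ) =
      (if k = i then zθ d a q (i : ℕ) * f (i : ℕ) else 0) +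
        (if (i : ℕ) = (k : ℕ) + 1 then f ((i : ℕ) - 1) else 0) := by
    intro k
    rcases eq_or_ne k i with rfl | hk
    · simp [matA, qθ, zθ]
    · have : (i : ℕ) ≠ k := fun h => hk (Fin.ext h.symm)
      by_cases h2 : (i : ℕ) = (k : ℕ) + 1 <;> simp [matA, this, hk, h2]
  simp only [key, Finset.sum_add_distrib, Finset.sum_ite_eq', Finset.mem_univ, if_true]
  congr 1
  rcases Nat.eq_zero_or_pos (i : ℕ) with h0 | h0
  · simp [h0, hf]
  · rw [Finset.sum_eq_single (⟨(i : ℕ) - 1, by omega⟩ : Fin (d + 1))]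
    · rw [if_pos]; simp only; omega
    · intro k _ hk
      rw [if_neg]
      intro h
      exact hk (Fin.ext (by simp only; omega))
    · simp

lemma matAs_apply_sum (d : ℕ) (a b c q : K) (f : ℤ → K) (i : Fin (d + 1)) :
    ∑ k : Fin (d + 1), matAs d a b c q i k * f (k : ℕ) =
      zθ d b q (i : ℕ) * f (i : ℕ) + zφ d a b c q ((i : ℕ) + 1) * f ((i : ℕ) + 1) := by
  have key : ∀ k : Fin (d + 1), matAs d a b c q i k * f (k : ℕ) =
      (if k = i then zθ d b q (i : ℕ) * f (i : ℕ) else 0) +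
        (if (k : ℕ) = (i : ℕ) + 1 then
          zφ d a b c q ((i : ℕ) + 1) * f ((i : ℕ) + 1) else 0) := by
    intro k
    rcases eq_or_ne k i with rfl | hk
    · simp [matAs, qθ, zθ]
    · have : (i : ℕ) ≠ k := fun h => hk (Fin.ext h.symm)
      by_cases h2 : (k : ℕ) = (i : ℕ) + 1
      · have h3 : qφ d a b c q (k : ℕ) = zφ d a b c q (k : ℕ) := rfl
        simp only [matAs, Matrix.of_apply, if_neg this, if_pos h2, if_neg hk, h3, zero_add]
        rw [h2, Nat.cast_add, Nat.cast_one]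
      · simp [matAs, this, hk, h2]
  simp only [key, Finset.sum_add_distrib, Finset.sum_ite_eq', Finset.mem_univ, if_true]
  congr 1
  by_cases h0 : (i : ℕ) = d
  · rw [h0, zφ_top]
    simp
  · rw [Finset.sum_eq_single (⟨(i : ℕ) + 1, by omega⟩ : Fin (d + 1))]
    · simp
    · intro k _ hk
      rw [if_neg]
      intro h
      exact hk (Fin.ext h)
    · simp

lemma sum_mul_matA (d : ℕ) (a q : K) (f : ℤ → K) (hf : f (d + 1) = 0) (j : Fin (d + 1)) :
    ∑ k : Fin (d + 1), f (k : ℕ) * matA d a q k j =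
      f (j : ℕ) * zθ d a q (j : ℕ) + f ((j : ℕ) + 1) := by
  have key : ∀ k : Fin (d + 1), f (k : ℕ) * matA d a q k j =
      (if k = j then f (j : ℕ) * zθ d a q (j : ℕ) else 0) +
        (if (k : ℕ) = (j : ℕ) + 1 then f ((j : ℕ) + 1) else 0) := by
    intro k
    rcases eq_or_ne k j with rfl | hk
    · simp [matA, qθ, zθ]
    · have : (k : ℕ) ≠ j := fun h => hk (Fin.ext h)
      by_cases h2 : (k : ℕ) = (j : ℕ) + 1 <;> simp [matA, this, hk, h2]
  simp only [key, Finset.sum_add_distrib, Finset.sum_ite_eq', Finset.mem_univ, if_true]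
  congr 1
  by_cases h0 : (j : ℕ) = d
  · rw [h0, hf]
    simp
  · rw [Finset.sum_eq_single (⟨(j : ℕ) + 1, by omega⟩ : Fin (d + 1))]
    · simp
    · intro k _ hk
      rw [if_neg]
      intro h
      exact hk (Fin.ext h)
    · simp

lemma zM_eq_zero_of_neg_one (d : ℕ) (a b c q : K) {n : ℕ} (hn : 1 ≤ n) :
    zM d a b c q (-1) n = 0 := by
  obtain ⟨m, rfl⟩ := Nat.exists_eq_add_of_le' hn
  simp [zM, qpoch_succ_left]

lemma zM_eq_zero_of_top (d : ℕ) (a b c q : K) (hq : q ≠ 0) {i : ℤ} {n : ℕ}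
    (hi : i + n = d + 1) (hn : 1 ≤ n) : zM d a b c q i n = 0 := by
  obtain ⟨m, rfl⟩ := Nat.exists_eq_add_of_le' hn
  have : q ^ (2 * i - 2 * (d : ℤ)) * (q ^ 2) ^ m = 1 := by
    rw [← pow_mul, ← zpow_natCast q (2 * m), ← zpow_add₀ hq]
    push_cast at hi ⊢
    rw [show 2 * i - 2 * (d : ℤ) + 2 * m = 0 by linarith, zpow_zero]
  simp [zM, qpoch_succ (q ^ (2 * i - 2 * (d : ℤ))), this]

/-- Moving up one row in a column of `matM`. -/
noncomputable def upRatio (d : ℕ) (a b c q : K) (i : ℤ) (n : ℕ) : K :=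
  -(b * c * q ^ (2 * (n : ℤ) + 1)) * (1 - q ^ (2 * i + 2)) * (1 - q ^ (2 * i - 2 * (d : ℤ))) *
    (1 - a⁻¹ * b⁻¹ * c⁻¹ * q ^ ((d : ℤ) - 2 * i - 1)) / (1 - q ^ (2 * (n : ℤ) + 2))

/-- Moving right one column in a row of `matM`. -/
noncomputable def rightRatio (d : ℕ) (a b c q : K) (i : ℤ) (n : ℕ) : K :=
  c * q ^ ((d : ℤ) - 2 * i) * (1 - q ^ (2 * i + 2 + 2 * (n : ℤ))) *
    (1 - q ^ (2 * i - 2 * (d : ℤ) + 2 * (n : ℤ))) *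
    (1 - a⁻¹ * b⁻¹ * c⁻¹ * q ^ ((d : ℤ) - 2 * (i + n) - 1)) / (1 - q ^ (2 * (n : ℤ) + 2))

/-- The contribution of the superdiagonal of `matAe`, relative to the current row. -/
noncomputable def downRatio (d : ℕ) (a b c q : K) (i : ℤ) (n : ℕ) : K :=
  -(a⁻¹ * b⁻¹ * q ^ (2 * (d : ℤ) - 3 * i - 2 * (n : ℤ))) * (1 - q ^ (2 * (n : ℤ))) *
    (q ^ (-i - 1) - a * b * c⁻¹ * q ^ (i - (d : ℤ)))

lemma zM_up (d : ℕ) (a b c q : K) (hb : b ≠ 0) (hq : q ≠ 0) (i : ℤ) (n : ℕ) :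
    zM d a b c q i (n + 1) = upRatio d a b c q i n * zM d a b c q (i + 1) n := by
  have e1 : q ^ (2 * i + 2) * q ^ 2 = q ^ (2 * (i + 1) + 2) := by
    rw [← zpow_natCast q 2, ← zpow_add₀ hq]; congr 1; push_cast; ring
  have e2 : q ^ (2 * i - 2 * (d : ℤ)) * q ^ 2 = q ^ (2 * (i + 1) - 2 * (d : ℤ)) := by
    rw [← zpow_natCast q 2, ← zpow_add₀ hq]; congr 1; push_cast; ring
  have e3 : q ^ ((d : ℤ) - 2 * (i + (n + 1 : ℕ)) + 1) * (q ^ 2) ^ n =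
      q ^ ((d : ℤ) - 2 * i - 1) := by
    rw [← pow_mul, ← zpow_natCast q (2 * n), ← zpow_add₀ hq]; congr 1; push_cast; ring
  have e4 : q ^ 2 * (q ^ 2) ^ n = q ^ (2 * (n : ℤ) + 2) := by
    rw [← pow_succ', ← pow_mul, ← zpow_natCast q]; congr 1
  have e5 : q ^ (i ^ 2 + ((d : ℤ) - 2 * i) * (i + (n + 1 : ℕ))) =
      q ^ (2 * (n : ℤ) + 1) *
        q ^ ((i + 1) ^ 2 + ((d : ℤ) - 2 * (i + 1)) * (i + 1 + n)) := by
    rw [← zpow_add₀ hq]; congr 1; push_cast; ring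
  have e6 : i + ((n + 1 : ℕ) : ℤ) = i + 1 + n := by push_cast; ring
  have e7 : (-1 : K) ^ (i + 1) = -(-1) ^ i := by
    rw [zpow_add₀ (by simp)]; simp
  have e8 : b ^ (-i) = b * b ^ (-(i + 1)) := by
    rw [← zpow_one_add₀ hb]; congr 1; ring
  rw [zM, qpoch_succ_left (q ^ (2 * i + 2)), qpoch_succ_left (q ^ (2 * i - 2 * (d : ℤ))),
    qpoch_succ (a⁻¹ * b⁻¹ * c⁻¹ * _), qpoch_succ (q ^ 2), mul_assoc (a⁻¹ * b⁻¹ * c⁻¹) _ _,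
    e1, e2, e3, e4, e5, e6, e8, zM, upRatio, e7, pow_succ]
  simp only [div_eq_mul_inv, mul_inv]
  ring

lemma zM_right (d : ℕ) (a b c q : K) (hq : q ≠ 0) (i : ℤ) (n : ℕ) :
    zM d a b c q i (n + 1) = rightRatio d a b c q i n * zM d a b c q i n := by
  have e1 : q ^ (2 * i + 2) * (q ^ 2) ^ n = q ^ (2 * i + 2 + 2 * (n : ℤ)) := by
    rw [← pow_mul, ← zpow_natCast q, ← zpow_add₀ hq]; rfl
  have e2 : q ^ (2 * i - 2 * (d : ℤ)) * (q ^ 2) ^ n =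
      q ^ (2 * i - 2 * (d : ℤ) + 2 * (n : ℤ)) := by
    rw [← pow_mul, ← zpow_natCast q, ← zpow_add₀ hq]; rfl
  have e3 : q ^ ((d : ℤ) - 2 * (i + (n + 1 : ℕ)) + 1) = q ^ ((d : ℤ) - 2 * (i + n) - 1) := by
    congr 1; push_cast; ring
  have e3' : q ^ ((d : ℤ) - 2 * (i + n) - 1) * q ^ 2 = q ^ ((d : ℤ) - 2 * (i + n) + 1) := by
    rw [← zpow_natCast q 2, ← zpow_add₀ hq]; congr 1; push_cast; ring
  have e4 : q ^ 2 * (q ^ 2) ^ n = q ^ (2 * (n : ℤ) + 2) := by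
    rw [← pow_succ', ← pow_mul, ← zpow_natCast q]; congr 1
  have e5 : q ^ (i ^ 2 + ((d : ℤ) - 2 * i) * (i + (n + 1 : ℕ))) =
      q ^ ((d : ℤ) - 2 * i) * q ^ (i ^ 2 + ((d : ℤ) - 2 * i) * (i + n)) := by
    rw [← zpow_add₀ hq]; congr 1; push_cast; ring
  rw [zM, e3, e5, qpoch_succ (q ^ (2 * i + 2)), qpoch_succ (q ^ (2 * i - 2 * (d : ℤ))),
    qpoch_succ_left (a⁻¹ * b⁻¹ * c⁻¹ * _), qpoch_succ (q ^ 2), mul_assoc (a⁻¹ * b⁻¹ * c⁻¹) _ _,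
    e1, e2, e3', e4, zM, rightRatio, pow_succ]
  simp only [div_eq_mul_inv, mul_inv]
  ring

lemma zpow_two_mul_eq (q : K) (i : ℤ) : q ^ (2 * i) = (q ^ i) ^ 2 := by
  rw [zpow_mul', zpow_ofNat]

lemma zpow_three_mul_eq (q : K) (i : ℤ) : q ^ (3 * i) = (q ^ i) ^ 3 := by
  rw [zpow_mul', zpow_ofNat]

lemma sq_sub_zpow_ne_zero {q : K} (hq : q ≠ 0) (h4 : q ^ 4 ≠ 1) : q ^ 2 - q ^ (-2 : ℤ) ≠ 0 := by
  intro h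
  apply h4
  have : q ^ (-2 : ℤ) = (q ^ 2)⁻¹ := by rw [zpow_neg, zpow_ofNat]
  rw [this] at h
  field_simp at h
  linear_combination h

lemma matAe_sub_coeff (d : ℕ) (b q : K) (hq : q ≠ 0) (h4 : q ^ 4 ≠ 1) (i : ℤ) :
    (q ^ 2 - q ^ (-2 : ℤ))⁻¹ * (q⁻¹ * zθ d b q i - q * zθ d b q (i - 1)) =
      -(b⁻¹ * q ^ ((d : ℤ) - 2 * i + 1)) := by
  rw [inv_mul_eq_iff_eq_mul₀ (sq_sub_zpow_ne_zero hq h4)]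
  simp only [zθ, mul_sub, zpow_add₀ hq, zpow_sub₀ hq, zpow_two_mul_eq, zpow_neg, zpow_ofNat,
    zpow_natCast]
  have := zpow_ne_zero i hq
  generalize q ^ i = Q at *
  have := pow_ne_zero d hq
  generalize q ^ d = D at *
  field_simp
  ring

lemma matAe_super_coeff (d : ℕ) (a q : K) (hq : q ≠ 0) (h4 : q ^ 4 ≠ 1) (i : ℤ) :
    (q ^ 2 - q ^ (-2 : ℤ))⁻¹ * (q⁻¹ * zθ d a q (i + 1) - q * zθ d a q i) =
      -(a⁻¹ * q ^ ((d : ℤ) - 2 * i - 1)) := by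
  have h := matAe_sub_coeff d a q hq h4 (i + 1)
  rw [add_sub_cancel_right] at h
  rw [h]
  congr 3
  ring

/-- The diagonal entries of `matAe`. -/
noncomputable def matAeDiag (d : ℕ) (a b c q : K) (i : ℤ) : K :=
  (q ^ 2 - q ^ (-2 : ℤ))⁻¹ * (q⁻¹ * (zθ d b q i * zθ d a q i + zφ d a b c q (i + 1)) -
      q * (zθ d a q i * zθ d b q i + zφ d a b c q i)) +
    ((a + a⁻¹) * (b + b⁻¹) + (c + c⁻¹) * (q ^ ((d : ℤ) + 1) + q ^ (-(d : ℤ) - 1))) /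
        (q + q⁻¹)

lemma super_mul_eq_downRatio_mul (d : ℕ) (a b c q : K) (ha : a ≠ 0) (hb : b ≠ 0) (hc : c ≠ 0)
    (hq : q ≠ 0) (i : ℤ) (n : ℕ) (hn : q ^ (2 * (n : ℤ) + 2) ≠ 1) :
    -(a⁻¹ * q ^ ((d : ℤ) - 2 * i - 1)) * zφ d a b c q (i + 1) =
      downRatio d a b c q i (n + 1) * upRatio d a b c q i n := by
  have hn' := sub_ne_zero.2 hn.symm
  rw [upRatio, mul_div_assoc', eq_div_iff hn']
  clear hn hn'
  simp only [zφ, downRatio, Nat.cast_add, Nat.cast_one, mul_add, mul_one, neg_add, zpow_add₀ hq,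
    zpow_sub₀ hq, zpow_two_mul_eq, zpow_three_mul_eq, zpow_neg, zpow_ofNat, zpow_natCast]
  have := zpow_ne_zero i hq
  generalize q ^ i = Q at *
  have := pow_ne_zero d hq
  generalize q ^ d = D at *
  have := pow_ne_zero n hq
  generalize q ^ n = N at *
  field_simp
  ring

lemma matAeDiag_eq (d : ℕ) (a b c q : K) (hq : q ≠ 0) (h4 : q ^ 4 ≠ 1) (i : ℤ) :
    matAeDiag d a b c q i =
      (q ^ 2 * (q⁻¹ * (zθ d b q i * zθ d a q i + zφ d a b c q (i + 1)) -
          q * (zθ d a q i * zθ d b q i + zφ d a b c q i)) +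
        q * (q ^ 2 - 1) * ((a + a⁻¹) * (b + b⁻¹) +
          (c + c⁻¹) * (q ^ ((d : ℤ) + 1) + q ^ (-(d : ℤ) - 1)))) / (q ^ 4 - 1) := by
  have h4' : q ^ 4 - 1 ≠ 0 := sub_ne_zero.2 h4
  have e1 : (q ^ 2 - q ^ (-2 : ℤ))⁻¹ = q ^ 2 / (q ^ 4 - 1) := by
    rw [inv_eq_one_div, div_eq_div_iff (sq_sub_zpow_ne_zero hq h4) h4', zpow_neg, zpow_ofNat]
    field_simp
  have h2 : q + q⁻¹ ≠ 0 := by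
    intro h
    apply h4
    field_simp at h
    linear_combination (q ^ 2 - 1) * h
  have e2 : (q + q⁻¹)⁻¹ = q * (q ^ 2 - 1) / (q ^ 4 - 1) := by
    rw [inv_eq_one_div, div_eq_div_iff h2 h4']
    field_simp
    ring
  rw [matAeDiag, div_eq_mul_inv, e1, e2]
  ring

lemma ratio_identity (d : ℕ) (a b c q : K) (ha : a ≠ 0) (hb : b ≠ 0) (hc : c ≠ 0)
    (hq : q ≠ 0) (h4 : q ^ 4 ≠ 1) (i : ℤ) (n : ℕ) (hn : q ^ (2 * (n : ℤ) + 2) ≠ 1) :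
    -(b⁻¹ * q ^ ((d : ℤ) - 2 * i + 1)) * upRatio d a b c q (i - 1) n +
        matAeDiag d a b c q i + downRatio d a b c q i n =
      zθ d c q (i + n) + rightRatio d a b c q i n := by
  have hn' := sub_ne_zero.2 hn.symm
  have h4' : q ^ 4 - 1 ≠ 0 := sub_ne_zero.2 h4
  rw [matAeDiag_eq d a b c q hq h4]
  simp only [zφ, zθ, downRatio, upRatio, rightRatio, mul_add, mul_one, neg_add, mul_sub,
    zpow_add₀ hq, zpow_sub₀ hq, zpow_two_mul_eq, zpow_three_mul_eq, zpow_neg,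
    zpow_ofNat, zpow_natCast] at hn' ⊢
  clear hn h4
  have := zpow_ne_zero i hq
  generalize q ^ i = Q at *
  have := pow_ne_zero d hq
  generalize q ^ d = D at *
  have := pow_ne_zero n hq
  generalize q ^ n = N at *
  generalize hR : 1 - N ^ 2 * q ^ 2 = R at *
  field_simp
  rw [← hR]
  ring

lemma corner_identity (d : ℕ) (a b c q : K) (ha : a ≠ 0) (hb : b ≠ 0) (hc : c ≠ 0)
    (hq : q ≠ 0) (h4 : q ^ 4 ≠ 1) :
    matAeDiag d a b c q 0 + downRatio d a b c q 0 d = zθ d c q d := by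
  have h4' : q ^ 4 - 1 ≠ 0 := sub_ne_zero.2 h4
  rw [matAeDiag_eq d a b c q hq h4]
  simp only [zφ, zθ, downRatio, mul_add, mul_one, neg_add, mul_sub,
    zpow_add₀ hq, zpow_sub₀ hq, zpow_two_mul_eq, zpow_three_mul_eq, zpow_neg,
    zpow_ofNat, zpow_natCast]
  clear h4
  have := pow_ne_zero d hq
  generalize q ^ d = D at *
  field_simp
  ring

lemma matAe_apply_sum (d : ℕ) (a b c q : K) (hq : q ≠ 0) (h4 : q ^ 4 ≠ 1) (f : ℤ → K)
    (hf : f (-1) = 0) (i : Fin (d + 1)) :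
    ∑ k : Fin (d + 1), matAe d a b c q i k * f (k : ℕ) =
      -(b⁻¹ * q ^ ((d : ℤ) - 2 * (i : ℕ) + 1)) * f ((i : ℕ) - 1) +
        matAeDiag d a b c q (i : ℕ) * f (i : ℕ) +
        -(a⁻¹ * q ^ ((d : ℤ) - 2 * (i : ℕ) - 1)) * zφ d a b c q ((i : ℕ) + 1) *
          f ((i : ℕ) + 1) := by
  have h1 : (matA d a q).mulVec (fun k => f (k : ℕ)) =
      fun k : Fin (d + 1) => zθ d a q (k : ℕ) * f (k : ℕ) + f ((k : ℕ) - 1) := by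
    funext k; exact matA_apply_sum d a q f hf k
  have h2 : (matAs d a b c q).mulVec (fun k => f (k : ℕ)) =
      fun k : Fin (d + 1) =>
        zθ d b q (k : ℕ) * f (k : ℕ) + zφ d a b c q ((k : ℕ) + 1) * f ((k : ℕ) + 1) := by
    funext k; exact matAs_apply_sum d a b c q f k
  have h3 := matAs_apply_sum d a b c q (fun k => zθ d a q k * f k + f (k - 1)) i
  have h4' := matA_apply_sum d a q
    (fun k => zθ d b q k * f k + zφ d a b c q (k + 1) * f (k + 1))
    (by simp [hf, zφ_zero]) i
  change (matAe d a b c q).mulVec (fun k => f (k : ℕ)) i = _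
  rw [matAe, Matrix.add_mulVec, Matrix.smul_mulVec, Matrix.sub_mulVec, Matrix.smul_mulVec,
    Matrix.smul_mulVec, Matrix.smul_mulVec, Matrix.one_mulVec, ← Matrix.mulVec_mulVec,
    ← Matrix.mulVec_mulVec, h1, h2]
  simp only [Pi.add_apply, Pi.smul_apply, Pi.sub_apply, smul_eq_mul]
  simp only [Matrix.mulVec, dotProduct]
  rw [h3, h4', ← matAe_sub_coeff d b q hq h4, ← matAe_super_coeff d a q hq h4, matAeDiag]
  simp only [add_sub_cancel_right, sub_add_cancel]
  ring

lemma zCol_recurrence (d : ℕ) (a b c q : K) (ha : a ≠ 0) (hb : b ≠ 0) (hc : c ≠ 0)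
    (hq : q ≠ 0) (h4 : q ^ 4 ≠ 1) (hroot : ∀ n : ℕ, 1 ≤ n → n ≤ d → q ^ (2 * n) ≠ 1)
    (i j : ℤ) (hi : 0 ≤ i) (hj : j ≤ d) :
    -(b⁻¹ * q ^ ((d : ℤ) - 2 * i + 1)) * zCol d a b c q j (i - 1) +
        matAeDiag d a b c q i * zCol d a b c q j i +
        -(a⁻¹ * q ^ ((d : ℤ) - 2 * i - 1)) * zφ d a b c q (i + 1) * zCol d a b c q j (i + 1) =
      zCol d a b c q j i * zθ d c q j + zCol d a b c q (j + 1) i := by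
  rcases lt_trichotomy i (j + 1) with hij | rfl | hij
  · obtain ⟨n, hn⟩ := Int.eq_ofNat_of_zero_le (show 0 ≤ j - i by omega)
    obtain rfl : j = i + n := by omega
    have hroot' : ∀ m : ℕ, m + 1 ≤ d → q ^ (2 * (m : ℤ) + 2) ≠ 1 := fun m hm h =>
      hroot (m + 1) (by omega) hm (by rw [← h, ← zpow_natCast]; rfl)
    have c0 : zCol d a b c q (i + n) i = zM d a b c q i n := by simp [zCol]
    have cup : zCol d a b c q (i + n) (i - 1) = zM d a b c q (i - 1) (n + 1) := by
      rw [zCol, if_pos (by omega)]; congr 1; omega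
    have cright : zCol d a b c q (i + n + 1) i = zM d a b c q i (n + 1) := by
      rw [zCol, if_pos (by omega)]; congr 1; omega
    have cdown : -(a⁻¹ * q ^ ((d : ℤ) - 2 * i - 1)) * zφ d a b c q (i + 1) *
        zCol d a b c q (i + n) (i + 1) = downRatio d a b c q i n * zM d a b c q i n := by
      rcases n with _ | m
      · simp [zCol, downRatio]
      · have : zCol d a b c q (i + (m + 1 : ℕ)) (i + 1) = zM d a b c q (i + 1) m := by
          rw [zCol, if_pos (by omega)]; congr 1; omega
        rw [this, super_mul_eq_downRatio_mul d a b c q ha hb hc hq i m (hroot' m (by omega)),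
          zM_up d a b c q hb hq i m, mul_assoc]
    rw [c0, cup, cright, cdown]
    by_cases hcorner : n + 1 ≤ d
    · rw [zM_up d a b c q hb hq, sub_add_cancel, zM_right d a b c q hq]
      linear_combination zM d a b c q i n *
        ratio_identity d a b c q ha hb hc hq h4 i n (hroot' n hcorner)
    · obtain rfl : i = 0 := by omega
      obtain rfl : n = d := by omega
      rw [zero_sub, zM_eq_zero_of_neg_one _ _ _ _ _ (by omega),
        zM_eq_zero_of_top n a b c q hq (i := 0) (n := n + 1) (by push_cast; ring) (by omega), zero_add]
      linear_combination zM n a b c q 0 n * corner_identity n a b c q ha hb hc hq h4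
  · have e1 : (-1 : K) ^ (j + 1) = -(-1) ^ j := by rw [zpow_add₀ (by simp)]; simp
    have e2 : b ^ (-(j + 1)) = b⁻¹ * b ^ (-j) := by
      rw [← zpow_neg_one, ← zpow_add₀ hb]; congr 1; ring
    have e3 : q ^ ((j + 1) ^ 2 + ((d : ℤ) - 2 * (j + 1)) * (j + 1)) =
        q ^ ((d : ℤ) - 2 * (j + 1) + 1) * q ^ (j ^ 2 + ((d : ℤ) - 2 * j) * j) := by
      rw [← zpow_add₀ hq]; congr 1; ring
    simp only [zCol, add_sub_cancel_right, le_refl, if_true, sub_self, Int.toNat_zero, zM, qpoch,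
      Finset.range_zero, Finset.prod_empty, Nat.cast_zero, add_zero, pow_zero, e1, e2, e3,
      if_neg (show ¬ j + 1 ≤ j by omega), if_neg (show ¬ j + 1 + 1 ≤ j by omega)]
    ring
  · simp [zCol, show ¬ i - 1 ≤ j by omega, show ¬ i ≤ j by omega, show ¬ i + 1 ≤ j by omega,
      show ¬ i ≤ j + 1 by omega]

lemma isUnit_det_matM (d : ℕ) (a b c q : K) (hb : b ≠ 0) (hq : q ≠ 0) :
    IsUnit (matM d a b c q).det := by
  have htri : (matM d a b c q).BlockTriangular id := fun i j hij => by
    have : ¬ (i : ℕ) ≤ (j : ℕ) := not_le.2 hij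
    simp only [matM, Matrix.of_apply, if_neg this]
  rw [Matrix.det_of_isUpperTriangular htri, isUnit_iff_ne_zero, Finset.prod_ne_zero_iff]
  intro i _
  simp [matM_eq_zCol, zCol, zM, qpoch, hb, hq, zpow_ne_zero]

end QRacah

/-- Proposition 12.7: A^ε·M = M·B where B is the lower bidiagonal matrix with
diagonal entries θ^ε_i = c·q^{2i−d} + c^{−1}·q^{d−2i} and subdiagonal entries 1;
equivalently M^{−1}·A^ε·M = B. -/
theorem stmt_11 {K : Type*} [Field K] [IsAlgClosed K] (d : ℕ) (hd : 3 ≤ d)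
    (a b c q : K) (h : QRACred d a b c q) :
    matAe d a b c q * matM d a b c q = matM d a b c q * matA d c q ∧
    (matM d a b c q)⁻¹ * matAe d a b c q * matM d a b c q = matA d c q := by
  obtain ⟨⟨ha, hb, hc, hq⟩, hroot, -, -⟩ := h
  have h4 : q ^ 4 ≠ 1 := hroot 2 (by omega) (by omega)
  have key : matAe d a b c q * matM d a b c q = matM d a b c q * matA d c q := by
    ext i j
    simp only [Matrix.mul_apply, matM_eq_zCol]
    have hneg : zCol d a b c q (j : ℕ) (-1) = 0 := by
      rw [zCol, if_pos (by omega), zM_eq_zero_of_neg_one _ _ _ _ _ (by omega)]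
    have htop : zCol d a b c q (d + 1) (i : ℕ) = 0 := by
      rw [zCol, if_pos (by omega), zM_eq_zero_of_top d a b c q hq (by omega) (by omega)]
    rw [matAe_apply_sum d a b c q hq h4 _ hneg,
      sum_mul_matA d c q (fun k => zCol d a b c q k (i : ℕ)) htop]
    exact zCol_recurrence d a b c q ha hb hc hq h4 hroot _ _ (by omega) (by omega)
  refine ⟨key, ?_⟩
  rw [mul_assoc, key, Matrix.nonsing_inv_mul_cancel_left _ _ (isUnit_det_matM d a b c q hb hq)]
end
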